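/- arXiv:2402.14138 — 2 statements merged into one kernel-verified Lean document; each statement's English description precedes it below -/
import Mathlib

section
/- Let x > 0 and let h be continuous on the closure of D₊, holomorphic on D₊, and satisfy |h(λ)| ≤ C/|λ| for some constant C and all λ in the closure of D₊ with |λ| ≥ 1. Then ∫_{∂D₊} e^{iλx} h(λ) dλ = 0. -/
open MeasureTheory

/-- ω(λ) = D₀λ² + iK₀λ. -/
noncomputable def omegaF (D₀ K₀ : ℝ) (l : ℂ) : ℂ := (D₀ : ℂ) * l ^ 2 + Complex.I * (K₀ : ℂ) * l

/-- The open region D₊ = {λ ∈ ℂ : Re ω(λ) < 0, Im λ > 0}. -/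
def DPlus (D₀ K₀ : ℝ) : Set ℂ := {l : ℂ | (omegaF D₀ K₀ l).re < 0 ∧ 0 < l.im}

/-- b₊(a) = (−K₀ + √(K₀² + 4D₀²a²))/(2D₀). -/
noncomputable def bPlus (D₀ K₀ a : ℝ) : ℝ :=
  (-K₀ + Real.sqrt (K₀ ^ 2 + 4 * D₀ ^ 2 * a ^ 2)) / (2 * D₀)

/-- Parametrization a ↦ a + i b₊(a) of the contour ∂D₊, oriented with increasing real part. -/
noncomputable def gammaPlus (D₀ K₀ a : ℝ) : ℂ := (a : ℂ) + Complex.I * (bPlus D₀ K₀ a : ℂ)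

/-- Derivative of the parametrization of ∂D₊. -/
noncomputable def gammaPlusD (D₀ K₀ a : ℝ) : ℂ :=
  1 + Complex.I * ((2 * D₀ * a / Real.sqrt (K₀ ^ 2 + 4 * D₀ ^ 2 * a ^ 2) : ℝ) : ℂ)

/-- The contour integral ∫_{∂D₊} φ(λ) dλ. -/
noncomputable def contourPlus (D₀ K₀ : ℝ) (φ : ℂ → ℂ) : ℂ :=
  ∫ a : ℝ, φ (gammaPlus D₀ K₀ a) * gammaPlusD D₀ K₀ a


lemma mem_DPlus_iff' (D₀ K₀ : ℝ) (hD : 0 < D₀) (hK : 0 < K₀) (l : ℂ) :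
    l ∈ DPlus D₀ K₀ ↔ bPlus D₀ K₀ l.re < l.im := by
  have h1 : (omegaF D₀ K₀ l).re = D₀ * (l.re ^ 2 - l.im ^ 2) - K₀ * l.im := by
    simp [omegaF, pow_two]
    ring
  have hb : bPlus D₀ K₀ l.re < l.im ↔
      Real.sqrt (K₀ ^ 2 + 4 * D₀ ^ 2 * l.re ^ 2) < 2 * D₀ * l.im + K₀ := by
    rw [bPlus, div_lt_iff₀ (by positivity)]
    constructor <;> intro h <;> linarith
  rw [hb]
  simp only [DPlus, Set.mem_ofPred_eq, h1]
  constructor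
  · rintro ⟨h2, h3⟩
    rw [Real.sqrt_lt' (by positivity)]
    nlinarith
  · intro h
    have hs : K₀ ≤ Real.sqrt (K₀ ^ 2 + 4 * D₀ ^ 2 * l.re ^ 2) :=
      Real.le_sqrt_of_sq_le (by nlinarith [sq_nonneg (D₀ * l.re)])
    have him : 0 < l.im := by
      have : 0 < D₀ * l.im := by linarith
      exact pos_of_mul_pos_right this hD.le
    refine ⟨?_, him⟩
    rw [Real.sqrt_lt' (by positivity)] at h
    have : 0 < (4 * D₀) * -(D₀ * (l.re ^ 2 - l.im ^ 2) - K₀ * l.im) := by nlinarith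
    have := pos_of_mul_pos_right this (by positivity)
    linarith

lemma bPlus_eq_norm (D₀ K₀ a : ℝ) :
    bPlus D₀ K₀ a = (-K₀ + ‖((K₀ : ℂ) + (2 * D₀ * a : ℝ) * Complex.I)‖) / (2 * D₀) := by
  rw [Complex.norm_add_mul_I, bPlus]
  congr 4
  ring

lemma bPlus_conv (D₀ K₀ : ℝ) (hD : 0 < D₀) (a b s t : ℝ) (hs : 0 ≤ s) (ht : 0 ≤ t)
    (hst : s + t = 1) :
    bPlus D₀ K₀ (s * a + t * b) ≤ s * bPlus D₀ K₀ a + t * bPlus D₀ K₀ b := by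
  simp only [bPlus_eq_norm]
  have h := norm_add_le (s • ((K₀ : ℂ) + (2 * D₀ * a : ℝ) * Complex.I))
    (t • ((K₀ : ℂ) + (2 * D₀ * b : ℝ) * Complex.I))
  rw [norm_smul_of_nonneg hs, norm_smul_of_nonneg ht] at h
  have e : s • ((K₀ : ℂ) + (2 * D₀ * a : ℝ) * Complex.I) +
      t • ((K₀ : ℂ) + (2 * D₀ * b : ℝ) * Complex.I) =
      (K₀ : ℂ) + (2 * D₀ * (s * a + t * b) : ℝ) * Complex.I := by
    have : t = 1 - s := by linarith
    subst this
    simp only [Complex.real_smul]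
    push_cast
    ring
  rw [e] at h
  rw [mul_div_assoc', mul_div_assoc', ← add_div]
  refine div_le_div_of_nonneg_right ?_ (by positivity)
  have : K₀ = s * K₀ + t * K₀ := by rw [← add_mul, hst, one_mul]
  linarith

lemma convex_DPlus (D₀ K₀ : ℝ) (hD : 0 < D₀) (hK : 0 < K₀) : Convex ℝ (DPlus D₀ K₀) := by
  intro z hz w hw s t hs ht hst
  rw [mem_DPlus_iff' _ _ hD hK] at *
  simp only [Complex.add_re, Complex.add_im, Complex.real_smul, Complex.re_ofReal_mul,
    Complex.im_ofReal_mul]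
  refine (bPlus_conv D₀ K₀ hD _ _ s t hs ht hst).trans_lt ?_
  rcases hs.eq_or_lt with rfl | hs'
  · have : t = 1 := by linarith
    subst this; linarith
  · have := mul_lt_mul_of_pos_left hz hs'
    have := mul_le_mul_of_nonneg_left hw.le ht
    linarith

lemma isOpen_DPlus (D₀ K₀ : ℝ) : IsOpen (DPlus D₀ K₀) := by
  have h1 : IsOpen {l : ℂ | (omegaF D₀ K₀ l).re < 0} := by
    unfold omegaF
    exact isOpen_lt (by fun_prop) continuous_const
  have h2 : IsOpen {l : ℂ | 0 < l.im} := isOpen_lt continuous_const Complex.continuous_im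
  exact h1.inter h2

lemma bPlus_mono (D₀ K₀ : ℝ) (hD : 0 < D₀) (a b : ℝ) (hab : |a| ≤ |b|) :
    bPlus D₀ K₀ a ≤ bPlus D₀ K₀ b := by
  unfold bPlus
  have := sq_le_sq.mpr hab
  gcongr

lemma bPlus_nonneg (D₀ K₀ : ℝ) (hD : 0 < D₀) (a : ℝ) :
    0 ≤ bPlus D₀ K₀ a := by
  unfold bPlus
  have hs : K₀ ≤ Real.sqrt (K₀ ^ 2 + 4 * D₀ ^ 2 * a ^ 2) :=
      Real.le_sqrt_of_sq_le (by nlinarith [sq_nonneg (D₀ * a)])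
  exact div_nonneg (by linarith) (by positivity)

lemma gammaPlus_re (D₀ K₀ a : ℝ) : (gammaPlus D₀ K₀ a).re = a := by
  simp [gammaPlus]

lemma gammaPlus_im (D₀ K₀ a : ℝ) : (gammaPlus D₀ K₀ a).im = bPlus D₀ K₀ a := by
  simp [gammaPlus]

lemma gammaPlus_hasDerivAt (D₀ K₀ : ℝ) (hD : 0 < D₀) (hK : 0 < K₀) (a : ℝ) :
    HasDerivAt (gammaPlus D₀ K₀) (gammaPlusD D₀ K₀ a) a := by
  have h0 : 0 < K₀ ^ 2 + 4 * D₀ ^ 2 * a ^ 2 := by positivity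
  have hs : HasDerivAt (bPlus D₀ K₀)
      (2 * D₀ * a / Real.sqrt (K₀ ^ 2 + 4 * D₀ ^ 2 * a ^ 2)) a := by
    have h1 : HasDerivAt (fun a : ℝ => K₀ ^ 2 + 4 * D₀ ^ 2 * a ^ 2) (4 * D₀ ^ 2 * (2 * a)) a := by
      simpa using ((hasDerivAt_pow 2 a).const_mul (4 * D₀ ^ 2)).const_add (K₀ ^ 2)
    have h2 := ((h1.sqrt h0.ne').const_add (-K₀)).div_const (2 * D₀)
    refine h2.congr_deriv ?_
    have := Real.sqrt_pos.mpr h0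
    field_simp
    ring
  exact (hasDerivAt_id a).ofReal_comp.add (hs.ofReal_comp.const_mul Complex.I)

lemma gammaPlus_cont (D₀ K₀ : ℝ) (hD : 0 < D₀) (hK : 0 < K₀) :
    Continuous (gammaPlus D₀ K₀) :=
  continuous_iff_continuousAt.mpr fun a => (gammaPlus_hasDerivAt D₀ K₀ hD hK a).continuousAt

lemma gammaPlusD_cont (D₀ K₀ : ℝ) (hK : 0 < K₀) :
    Continuous (gammaPlusD D₀ K₀) := by
  unfold gammaPlusD
  refine continuous_const.add (continuous_const.mul (Complex.continuous_ofReal.comp ?_))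
  refine Continuous.div (by fun_prop) (by fun_prop) fun a => ?_
  have h0 : 0 < K₀ ^ 2 + 4 * D₀ ^ 2 * a ^ 2 := by positivity
  exact (Real.sqrt_pos.mpr h0).ne'

lemma shift_mem (D₀ K₀ : ℝ) (hD : 0 < D₀) (hK : 0 < K₀) (a s : ℝ) (hs : 0 < s) :
    gammaPlus D₀ K₀ a + Complex.I * s ∈ DPlus D₀ K₀ := by
  rw [mem_DPlus_iff' _ _ hD hK]
  simp [gammaPlus_re, gammaPlus_im, hs]

lemma shift_mem_closure (D₀ K₀ : ℝ) (hD : 0 < D₀) (hK : 0 < K₀) (a s : ℝ) (hs : 0 ≤ s) :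
    gammaPlus D₀ K₀ a + Complex.I * s ∈ closure (DPlus D₀ K₀) := by
  have hc : Continuous fun s : ℝ => gammaPlus D₀ K₀ a + Complex.I * (s : ℂ) := by fun_prop
  have h1 : s ∈ closure (Set.Ioi (0 : ℝ)) := by rw [closure_Ioi]; exact hs
  exact map_mem_closure (f := fun s : ℝ => gammaPlus D₀ K₀ a + Complex.I * (s : ℂ)) hc h1
    fun t ht => shift_mem D₀ K₀ hD hK a t ht

lemma up_mem (D₀ K₀ : ℝ) (hD : 0 < D₀) (hK : 0 < K₀) (z : ℂ) (hz : z ∈ DPlus D₀ K₀)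
    (t : ℝ) (ht : 0 ≤ t) : z + Complex.I * t ∈ DPlus D₀ K₀ := by
  rw [mem_DPlus_iff' _ _ hD hK] at *
  simp
  linarith

lemma vert_est (D₀ K₀ : ℝ) (hD : 0 < D₀) (hK : 0 < K₀) (x : ℝ) (hx : 0 < x)
    (f G : ℂ → ℂ) (M : ℝ) (hG : ∀ z ∈ DPlus D₀ K₀, HasDerivAt G (f z) z)
    (z : ℂ) (hz : z ∈ DPlus D₀ K₀)
    (hf : ∀ t : ℝ, 0 ≤ t → ‖f (z + Complex.I * t)‖ ≤ M * Real.exp (-(x * t)))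
    (T : ℝ) (hT : 0 ≤ T) : ‖G (z + Complex.I * T) - G z‖ ≤ M / x := by
  have hM : 0 ≤ M := by
    have := hf 0 le_rfl
    simp at this
    exact (norm_nonneg _).trans this
  have hd : ∀ t : ℝ, 0 ≤ t → HasDerivAt (fun t : ℝ => G (z + Complex.I * t) - G z)
      (f (z + Complex.I * t) * Complex.I) t := by
    intro t ht
    have h1 : HasDerivAt (fun t : ℝ => z + Complex.I * (t : ℂ)) Complex.I t := by
      simpa using ((hasDerivAt_id t).ofReal_comp.const_mul Complex.I).const_add z
    exact ((hG _ (up_mem D₀ K₀ hD hK z hz t ht)).comp t h1).sub_const (G z)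
  have hB : ∀ t : ℝ, HasDerivAt (fun t : ℝ => M / x * (1 - Real.exp (-(x * t))))
      (M * Real.exp (-(x * t))) t := by
    intro t
    have h1 : HasDerivAt (fun t : ℝ => -(x * t)) (-x) t := by
      simpa using (hasDerivAt_id t).const_mul (-x)
    refine ((h1.exp.const_sub 1).const_mul (M / x)).congr_deriv ?_
    field_simp
  have := image_norm_le_of_norm_deriv_right_le_deriv_boundary (a := 0) (b := T)
    (f := fun t : ℝ => G (z + Complex.I * t) - G z)
    (f' := fun t : ℝ => f (z + Complex.I * t) * Complex.I)
    (fun t ht => (hd t ht.1).continuousAt.continuousWithinAt)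
    (fun t ht => (hd t ht.1).hasDerivWithinAt)
    (B := fun t : ℝ => M / x * (1 - Real.exp (-(x * t))))
    (B' := fun t : ℝ => M * Real.exp (-(x * t)))
    (by simp) hB
    (fun t ht => by simpa using hf t ht.1) (x := T) ⟨hT, le_rfl⟩
  refine this.trans ?_
  have h2 : 0 ≤ M / x := by positivity
  have := Real.exp_pos (-(x * T))
  nlinarith

lemma hor_est (D₀ K₀ : ℝ) (hD : 0 < D₀) (hK : 0 < K₀) (f G : ℂ → ℂ) (M : ℝ)
    (hG : ∀ z ∈ DPlus D₀ K₀, HasDerivAt G (f z) z) (R y : ℝ) (hR : 0 ≤ R)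
    (hy : bPlus D₀ K₀ R < y)
    (hf : ∀ u : ℝ, ‖f (u + Complex.I * y)‖ ≤ M ∨ u ∉ Set.Icc (-R) R) :
    ‖G ((R : ℝ) + Complex.I * y) - G ((-R : ℝ) + Complex.I * y)‖ ≤ M * (2 * R) := by
  have hd : ∀ u ∈ Set.Icc (-R) R, HasDerivWithinAt (fun u : ℝ => G (u + Complex.I * y))
      (f (u + Complex.I * y)) (Set.Icc (-R) R) u := by
    intro u hu
    have h1 : HasDerivAt (fun u : ℝ => (u : ℂ) + Complex.I * (y : ℂ)) 1 u := by
      simpa using ((hasDerivAt_id u).ofReal_comp).add_const (Complex.I * (y : ℂ))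
    have hm : (u : ℂ) + Complex.I * y ∈ DPlus D₀ K₀ := by
      rw [mem_DPlus_iff' _ _ hD hK]
      simp
      refine (bPlus_mono D₀ K₀ hD u R ?_).trans_lt hy
      rw [abs_of_nonneg hR]
      exact abs_le.mpr hu
    have h2 := ((hG _ hm).comp u h1).hasDerivWithinAt (s := Set.Icc (-R) R)
    rw [mul_one] at h2
    exact h2
  have := norm_image_sub_le_of_norm_deriv_le_segment' hd
    (C := M) (fun u hu => (hf u).resolve_right (fun h => h ⟨hu.1, hu.2.le⟩)) R
    ⟨by linarith, le_rfl⟩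
  convert this using 1
  ring

/-- Jordan-type lemma: if h is continuous on the closure of D₊, holomorphic on D₊, and
|h(λ)| ≤ C/|λ| for |λ| ≥ 1 on the closure of D₊, then ∫_{∂D₊} e^{iλx} h(λ) dλ = 0 for x > 0. -/
theorem statement_8 (D₀ K₀ : ℝ) (hD : 0 < D₀) (hK : 0 < K₀)
    (x : ℝ) (hx : 0 < x) (h : ℂ → ℂ) (C : ℝ)
    (hcont : ContinuousOn h (closure (DPlus D₀ K₀)))
    (hhol : DifferentiableOn ℂ h (DPlus D₀ K₀))
    (hbound : ∀ l ∈ closure (DPlus D₀ K₀), 1 ≤ ‖l‖ →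
      ‖h l‖ ≤ C / ‖l‖) :
    contourPlus D₀ K₀ (fun l => Complex.exp (Complex.I * l * (x : ℂ)) * h l) = 0 := by
  classical
  have hsub : DPlus D₀ K₀ ⊆ closure (DPlus D₀ K₀) := subset_closure
  set f : ℂ → ℂ := fun l => Complex.exp (Complex.I * l * (x : ℂ)) * h l with hfdef
  have hfn : ∀ l, ‖f l‖ = Real.exp (-(x * l.im)) * ‖h l‖ := by
    intro l
    rw [hfdef]
    simp only [norm_mul, Complex.norm_exp]
    congr 2
    simp
    ring
  have hfd : DifferentiableOn ℂ f (DPlus D₀ K₀) :=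
    DifferentiableOn.mul (by fun_prop) hhol
  have hfc : ContinuousOn f (closure (DPlus D₀ K₀)) :=
    ContinuousOn.mul (by fun_prop) hcont
  obtain ⟨G, hG0⟩ := (convex_DPlus D₀ K₀ hD hK).exists_forall_hasDerivWithinAt hfd
  have hG : ∀ z ∈ DPlus D₀ K₀, HasDerivAt G (f z) z := fun z hz =>
    (hG0 z hz).hasDerivAt ((isOpen_DPlus D₀ K₀).mem_nhds hz)
  have hC : 0 ≤ C := by
    have h1 := hbound _ (shift_mem_closure D₀ K₀ hD hK 1 0 le_rfl)
    have h2 : 1 ≤ ‖gammaPlus D₀ K₀ 1 + Complex.I * (0 : ℝ)‖ := by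
      refine le_trans ?_ (Complex.abs_re_le_norm _)
      simp [gammaPlus_re]
    have h3 := (norm_nonneg _).trans (h1 h2)
    by_contra hneg
    push Not at hneg
    have := div_neg_of_neg_of_pos hneg (lt_of_lt_of_le one_pos h2)
    linarith
  -- estimate for the primitive
  have key : ∀ R : ℝ, 1 ≤ R → ∀ s : ℝ, 0 < s →
      ‖G (gammaPlus D₀ K₀ R + Complex.I * s) - G (gammaPlus D₀ K₀ (-R) + Complex.I * s)‖
        ≤ 2 * (C / R / x) := by
    intro R hR s hs
    have hv : ∀ u : ℝ, |u| = R → ∀ T : ℝ, 0 ≤ T →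
        ‖G (gammaPlus D₀ K₀ u + Complex.I * s + Complex.I * T) -
          G (gammaPlus D₀ K₀ u + Complex.I * s)‖ ≤ C / R / x := by
      intro u hu T hT
      have hz := shift_mem D₀ K₀ hD hK u s hs
      refine vert_est D₀ K₀ hD hK x hx f G (C / R) hG _ hz ?_ T hT
      intro t ht
      have hm := up_mem D₀ K₀ hD hK _ hz t ht
      have hn : R ≤ ‖gammaPlus D₀ K₀ u + Complex.I * s + Complex.I * t‖ := by
        refine le_trans ?_ (Complex.abs_re_le_norm _)
        simp [gammaPlus_re, hu]
      rw [hfn, mul_comm]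
      have h1 := hbound _ (hsub hm) (hR.trans hn)
      have h2 : C / ‖gammaPlus D₀ K₀ u + Complex.I * s + Complex.I * t‖ ≤ C / R := by
        gcongr
      refine mul_le_mul (h1.trans h2) ?_ (Real.exp_pos _).le (by positivity)
      rw [Real.exp_le_exp]
      simp [gammaPlus_im]
      have := bPlus_nonneg D₀ K₀ hD u
      nlinarith
    have hT : ∀ T : ℝ, 0 ≤ T →
      ‖G (gammaPlus D₀ K₀ R + Complex.I * s) - G (gammaPlus D₀ K₀ (-R) + Complex.I * s)‖
        ≤ 2 * (C / R / x) + (Real.exp (-(x * T)) * C) * (2 * R) := by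
      intro T hT0
      have hb : bPlus D₀ K₀ (-R) = bPlus D₀ K₀ R := by simp [bPlus]
      set y : ℝ := bPlus D₀ K₀ R + s + (T + 1) with hy
      have hbn := bPlus_nonneg D₀ K₀ hD R
      have e1 : gammaPlus D₀ K₀ R + Complex.I * s + Complex.I * ((T + 1 : ℝ) : ℂ) =
          (R : ℝ) + Complex.I * y := by
        simp only [gammaPlus, hy]; push_cast; ring
      have e2 : gammaPlus D₀ K₀ (-R) + Complex.I * s + Complex.I * ((T + 1 : ℝ) : ℂ) =
          (-R : ℝ) + Complex.I * y := by
        simp only [gammaPlus, hy, hb]; push_cast; ring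
      have h1 := hv R (abs_of_nonneg (by linarith)) (T + 1) (by linarith)
      have h2 := hv (-R) (by rw [abs_neg]; exact abs_of_nonneg (by linarith)) (T + 1)
        (by linarith)
      rw [e1] at h1
      rw [e2] at h2
      have h3 := hor_est D₀ K₀ hD hK f G (Real.exp (-(x * T)) * C) hG R y (by linarith)
        (by linarith) (by
          intro u
          by_cases hu : u ∈ Set.Icc (-R) R
          swap
          · exact Or.inr hu
          left
          have hm : (u : ℂ) + Complex.I * y ∈ DPlus D₀ K₀ := by
            rw [mem_DPlus_iff' _ _ hD hK]
            simp
            refine (bPlus_mono D₀ K₀ hD u R ?_).trans_lt (by linarith)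
            rw [abs_of_nonneg (by linarith : 0 ≤ R)]
            exact abs_le.mpr hu
          have hn : 1 ≤ ‖(u : ℂ) + Complex.I * y‖ := by
            refine le_trans ?_ (Complex.abs_im_le_norm _)
            refine le_trans ?_ (le_abs_self _)
            simp
            linarith
          rw [hfn]
          refine mul_le_mul ?_ ((hbound _ (hsub hm) hn).trans (div_le_self hC hn))
            (norm_nonneg _) (Real.exp_pos _).le
          rw [Real.exp_le_exp]
          simp
          nlinarith)
      set A := G (gammaPlus D₀ K₀ R + Complex.I * s)
      set B := G (gammaPlus D₀ K₀ (-R) + Complex.I * s)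
      set A' := G ((R : ℝ) + Complex.I * y)
      set B' := G ((-R : ℝ) + Complex.I * y)
      have e : A - B = -(A' - A) + (B' - B) + (A' - B') := by ring
      rw [e]
      refine (norm_add₃_le).trans ?_
      rw [norm_neg]
      linarith
    have hlim : Filter.Tendsto
        (fun T : ℝ => 2 * (C / R / x) + (Real.exp (-(x * T)) * C) * (2 * R)) Filter.atTop
        (nhds (2 * (C / R / x) + (0 * C) * (2 * R))) := by
      refine Filter.Tendsto.const_add _ ((Filter.Tendsto.mul_const _ ?_).mul_const _)
      exact Real.tendsto_exp_neg_atTop_nhds_zero.comp (Filter.tendsto_id.const_mul_atTop hx)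
    have := ge_of_tendsto hlim (Filter.eventually_atTop.mpr ⟨0, hT⟩)
    simpa using this
  have hFc : Continuous (Function.uncurry fun (s a : ℝ) =>
      f (gammaPlus D₀ K₀ a + Complex.I * (|s| : ℝ)) * gammaPlusD D₀ K₀ a) := by
    have h1 := gammaPlus_cont D₀ K₀ hD hK
    have h2 := gammaPlusD_cont D₀ K₀ hK
    refine Continuous.mul ?_ (h2.comp continuous_snd)
    refine hfc.comp_continuous ?_ fun p =>
      shift_mem_closure D₀ K₀ hD hK p.2 |p.1| (abs_nonneg _)
    fun_prop
  have hint : ∀ R : ℝ, 1 ≤ R →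
      ‖∫ a in (-R)..R, f (gammaPlus D₀ K₀ a) * gammaPlusD D₀ K₀ a‖ ≤ 2 * (C / R / x) := by
    intro R hR
    have hc := intervalIntegral.continuous_parametric_intervalIntegral_of_continuous'
      (μ := volume) hFc (-R) R
    have ht := (hc.norm.tendsto 0).mono_left (nhdsWithin_le_nhds (s := Set.Ioi (0 : ℝ)))
    simp only [abs_zero, Complex.ofReal_zero, mul_zero, add_zero] at ht
    refine le_of_tendsto ht ?_
    filter_upwards [self_mem_nhdsWithin] with s hs
    have hs' : 0 < s := hs
    rw [abs_of_pos hs']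
    rw [intervalIntegral.integral_eq_sub_of_hasDerivAt
      (f := fun a => G (gammaPlus D₀ K₀ a + Complex.I * s))]
    · exact key R hR s hs'
    · intro a _
      exact (hG _ (shift_mem D₀ K₀ hD hK a s hs')).comp a
        ((gammaPlus_hasDerivAt D₀ K₀ hD hK a).add_const _)
    · have := hFc.comp (Continuous.prodMk_right s)
      simp only [Function.comp_def, Function.uncurry, abs_of_pos hs'] at this
      exact this.intervalIntegrable _ _
  unfold contourPlus
  by_cases hi : Integrable fun a : ℝ => f (gammaPlus D₀ K₀ a) * gammaPlusD D₀ K₀ a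
  · have h1 := intervalIntegral_tendsto_integral hi Filter.tendsto_neg_atTop_atBot
      Filter.tendsto_id
    refine tendsto_nhds_unique h1 ?_
    refine squeeze_zero_norm' (Filter.eventually_atTop.mpr ⟨1, hint⟩) ?_
    have : Filter.Tendsto (fun R : ℝ => 2 * (C / R / x)) Filter.atTop
        (nhds (2 * (0 / x))) :=
      Filter.Tendsto.const_mul _ (Filter.Tendsto.div_const
        (Filter.Tendsto.const_div_atTop Filter.tendsto_id C) x)
    simpa using this
  · exact integral_undef hi
end

section
/- (Rainfall with time-dependent surface value, Example 2.) Let θ₀ > 0, let f₂ ∈ C([0,∞)) with f₂(0) = θ₀, and let u be a classical solution of ∂u/∂t + K₀ ∂u/∂x = D₀ ∂²u/∂x² on (0,L) × (0,∞) with u(x,0) = 0 for 0 < x < L, u(0,t) = f₂(t) − θ₀ and u(L,t) = 0 for t > 0. Then for every 0 < x < L and t > 0, u(x,t) = θ₀ (2D₀/π) e^{−K₀(L−x)/(2D₀)} ∫_{∂D₊} ((1 − e^{−ω(λ)t})/(ω(λ)Δ(λ))) (λ + iK₀/(2D₀)) sin((L−x)(λ + iK₀/(2D₀))) dλ − (2D₀/π)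 e^{−K₀(L−x)/(2D₀)} ∫_{∂D₊} (e^{−ω(λ)t}/Δ(λ)) f̃₂(ω(λ),t) (λ + iK₀/(2D₀)) sin((L−x)(λ + iK₀/(2D₀))) dλ, where f̃₂(ω,t) = ∫₀^t e^{ωτ} f₂(τ) dτ and the first integrand is extended to λ = 0 by its limiting value. -/
open MeasureTheory

/-- ν(λ) = −λ − iK₀/D₀. -/
noncomputable def nuF (D₀ K₀ : ℝ) (l : ℂ) : ℂ := -l - Complex.I * ((K₀ : ℂ) / (D₀ : ℂ))

/-- Δ(λ) = e^{−iλL} − e^{−iν(λ)L}. -/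
noncomputable def deltaF (D₀ K₀ L : ℝ) (l : ℂ) : ℂ :=
  Complex.exp (-Complex.I * l * (L : ℂ)) - Complex.exp (-Complex.I * nuF D₀ K₀ l * (L : ℂ))

/-- θ̂₀(λ) = ∫₀^L e^{−iλξ} θ₀(ξ) dξ. -/
noncomputable def hatF (L : ℝ) (θ₀ : ℝ → ℝ) (l : ℂ) : ℂ :=
  ∫ ξ in (0:ℝ)..L, Complex.exp (-Complex.I * l * (ξ : ℂ)) * (θ₀ ξ : ℂ)

/-- φ̃(λ,t) = ∫₀^t e^{λτ} φ(τ) dτ. -/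
noncomputable def tildeF (φ : ℝ → ℝ) (l : ℂ) (t : ℝ) : ℂ :=
  ∫ τ in (0:ℝ)..t, Complex.exp (l * (τ : ℂ)) * (φ τ : ℂ)

/-- A classical solution of the IBVP ∂θ/∂t + K₀ ∂θ/∂x = D₀ ∂²θ/∂x² on (0,L)×(0,∞) with
data (θ₀, f, g): a bounded continuous function on [0,L]×[0,∞), C² in x and C¹ in t on
(0,L)×(0,∞), whose x-derivative θx extends continuously to [0,L]×(0,∞), satisfying the PDE
and the initial and boundary conditions. -/
def IsClassicalSolution (D₀ K₀ L : ℝ) (θ θx : ℝ → ℝ → ℝ) (θ₀ f g : ℝ → ℝ) : Prop :=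
  ContinuousOn (fun p : ℝ × ℝ => θ p.1 p.2) (Set.Icc 0 L ×ˢ Set.Ici 0) ∧
  (∃ M, ∀ x ∈ Set.Icc (0:ℝ) L, ∀ t ∈ Set.Ici (0:ℝ), |θ x t| ≤ M) ∧
  ContinuousOn (fun p : ℝ × ℝ => θx p.1 p.2) (Set.Icc 0 L ×ˢ Set.Ioi 0) ∧
  (∀ x ∈ Set.Ioo (0:ℝ) L, ∀ t ∈ Set.Ioi (0:ℝ),
    HasDerivAt (fun x' => θ x' t) (θx x t) x ∧
    DifferentiableAt ℝ (fun x' => θx x' t) x ∧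
    HasDerivAt (fun τ => θ x τ) (D₀ * deriv (fun x' => θx x' t) x - K₀ * θx x t) t) ∧
  (∀ x ∈ Set.Icc (0:ℝ) L, θ x 0 = θ₀ x) ∧
  (∀ t > (0:ℝ), θ 0 t = f t) ∧
  (∀ t > (0:ℝ), θ L t = g t)

section
open MeasureTheory Set Filter Topology

lemma aux_second (f f1 : ℝ → ℝ) (f2 x₀ : ℝ) (h1 : ∀ᶠ x in 𝓝 x₀, HasDerivAt f (f1 x) x)
    (h2 : HasDerivAt f1 f2 x₀) (hm : IsLocalMax f x₀) : f1 x₀ = 0 ∧ f2 ≤ 0 := by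
  have e1 : deriv f =ᶠ[𝓝 x₀] f1 := h1.mono fun x hx => hx.deriv
  have hz : f1 x₀ = 0 := hm.hasDerivAt_eq_zero h1.self_of_nhds
  refine ⟨hz, ?_⟩
  by_contra hpos
  push Not at hpos
  have hdd : deriv (deriv f) x₀ = f2 := by rw [e1.deriv_eq]; exact h2.deriv
  have hmin : IsLocalMin f x₀ := isLocalMin_of_deriv_deriv_pos (by rw [hdd]; exact hpos)
    (by rw [e1.self_of_nhds]; exact hz) h1.self_of_nhds.continuousAt
  have hconst : f =ᶠ[𝓝 x₀] fun _ => f x₀ := by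
    filter_upwards [hm, hmin] with x a b using le_antisymm a b
  have : deriv (deriv f) x₀ = 0 := by
    rw [hconst.deriv.deriv_eq]; simp
  linarith

lemma aux_left (f : ℝ → ℝ) (f' t₀ T : ℝ) (hT : t₀ < T) (h : HasDerivAt f f' T)
    (hm : ∀ s ∈ Icc t₀ T, f s ≤ f T) : 0 ≤ f' := by
  have h1 : Tendsto (slope f T) (𝓝[<] T) (𝓝 f') :=
    (hasDerivAt_iff_tendsto_slope.1 h).mono_left (nhdsWithin_mono _ fun x hx => ne_of_lt hx)
  refine ge_of_tendsto h1 ?_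
  filter_upwards [Ioo_mem_nhdsLT hT] with s hs
  rw [slope_def_field]
  have := hm s ⟨hs.1.le, hs.2.le⟩
  exact div_nonneg_of_nonpos (by linarith) (by linarith [hs.2])

lemma aux_maxp (D K L t₀ T m : ℝ) (hD : 0 < D)
    (v vx vxx vt : ℝ → ℝ → ℝ)
    (hc : ContinuousOn (fun p : ℝ × ℝ => v p.1 p.2) (Icc 0 L ×ˢ Icc t₀ T))
    (hd : ∀ x ∈ Ioo 0 L, ∀ t ∈ Ioc t₀ T, HasDerivAt (fun x' => v x' t) (vx x t) x ∧
      HasDerivAt (fun x' => vx x' t) (vxx x t) x ∧ HasDerivAt (fun t' => v x t') (vt x t) t ∧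
      vt x t ≤ D * vxx x t - K * vx x t)
    (h0 : ∀ t ∈ Ioc t₀ T, v 0 t ≤ m) (h1 : ∀ t ∈ Ioc t₀ T, v L t ≤ m)
    (hi : ∀ x ∈ Icc 0 L, v x t₀ ≤ m) :
    ∀ x ∈ Icc 0 L, ∀ t ∈ Icc t₀ T, v x t ≤ m := by
  intro x hx t ht
  -- perturbation
  suffices H : ∀ ε > 0, v x t - ε * (t - t₀) ≤ m by
    have : Tendsto (fun ε : ℝ => v x t - ε * (t - t₀)) (𝓝[>] 0) (𝓝 (v x t - 0 * (t - t₀))) := by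
      apply Tendsto.mono_left _ nhdsWithin_le_nhds
      apply Continuous.tendsto
      fun_prop
    have h := le_of_tendsto this (by filter_upwards [self_mem_nhdsWithin] with ε hε using H ε hε)
    simpa using h
  intro ε hε
  have hcomp : IsCompact (Icc (0:ℝ) L ×ˢ Icc t₀ T) := isCompact_Icc.prod isCompact_Icc
  obtain ⟨⟨y, s⟩, ⟨hy, hs⟩, hmax⟩ := hcomp.exists_isMaxOn
    (f := fun p : ℝ × ℝ => v p.1 p.2 - ε * (p.2 - t₀)) ⟨(x, t), hx, ht⟩
    (hc.sub (by fun_prop))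
  simp only at hy hs
  have hmax' : ∀ a ∈ Icc 0 L, ∀ b ∈ Icc t₀ T, v a b - ε * (b - t₀) ≤ v y s - ε * (s - t₀) :=
    fun a ha b hb => hmax (show (a, b) ∈ _ from ⟨ha, hb⟩)
  refine (hmax' x hx t ht).trans ?_
  rcases hs.1.eq_or_lt with e | hs0
  · subst e
    simpa using hi y hy
  have hεs : 0 < ε * (s - t₀) := mul_pos hε (by linarith)
  have hs' : s ∈ Ioc t₀ T := ⟨hs0, hs.2⟩
  rcases hy.1.eq_or_lt with e | hy0
  · subst e
    linarith [h0 s hs']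
  rcases hy.2.eq_or_lt with e | hy1
  · subst e
    linarith [h1 s hs']
  exfalso
  obtain ⟨d1, d2, d3, d4⟩ := hd y ⟨hy0, hy1⟩ s hs'
  have hnb : Ioo 0 L ∈ 𝓝 y := Ioo_mem_nhds hy0 hy1
  have hA := aux_second (fun x' => v x' s) (fun x' => vx x' s) (vxx y s) y
    (by filter_upwards [hnb] with z hz using (hd z hz s hs').1) d2
    (by
      filter_upwards [hnb] with z hz
      have := hmax' z ⟨hz.1.le, hz.2.le⟩ s hs
      linarith)
  have hB := aux_left (fun t' => v y t' - ε * (t' - t₀)) (vt y s - ε * 1) t₀ s hs0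
    (d3.sub (((hasDerivAt_id s).sub_const t₀).const_mul ε))
    (fun r hr => hmax' y hy r ⟨hr.1, hr.2.trans hs.2⟩)
  rw [hA.1] at d4
  nlinarith [hA.2]

/-- bounded ancient solutions obey the lateral bound -/
lemma aux_ancient (D K L T m M : ℝ) (hD : 0 < D) (hK : 0 < K) (hL : 0 < L) (hm : 0 ≤ m)
    (v vx vxx vt : ℝ → ℝ → ℝ)
    (hc : ContinuousOn (fun p : ℝ × ℝ => v p.1 p.2) (Icc 0 L ×ˢ univ))
    (hd : ∀ x ∈ Ioo 0 L, ∀ t, HasDerivAt (fun x' => v x' t) (vx x t) x ∧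
      HasDerivAt (fun x' => vx x' t) (vxx x t) x ∧ HasDerivAt (fun t' => v x t') (vt x t) t ∧
      vt x t ≤ D * vxx x t - K * vx x t)
    (h0 : ∀ t ≤ T, v 0 t ≤ m) (h1 : ∀ t ≤ T, v L t ≤ m)
    (hM : ∀ x ∈ Icc 0 L, ∀ t, v x t ≤ M) :
    ∀ x ∈ Icc 0 L, ∀ t ≤ T, v x t ≤ m := by
  intro x hx t ht
  set N := max M 0 with hN
  have hN0 : 0 ≤ N := le_max_right _ _
  set c := K / (2 * L) with hcdef
  have hc0 : 0 < c := by positivity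
  have key : ∀ t₀ ≤ t, v x t ≤ m + N * Real.exp (-c * (t - t₀)) * (1 + x / L) := by
    intro t₀ ht₀
    have := aux_maxp D K L t₀ T m hD
      (fun x t => v x t - N * Real.exp (-c * (t - t₀)) * (1 + x / L))
      (fun x t => vx x t - N * Real.exp (-c * (t - t₀)) * (1 / L))
      (fun x t => vxx x t)
      (fun x t => vt x t - N * (Real.exp (-c * (t - t₀)) * (-c * 1)) * (1 + x / L))
      ((hc.mono (prod_mono_right (subset_univ _))).sub (by fun_prop))
      (by
        intro y hy s hs
        obtain ⟨d1, d2, d3, d4⟩ := hd y hy s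
        refine ⟨d1.sub ((((hasDerivAt_id y).div_const L).const_add 1).const_mul _),
          d2.sub_const _, d3.sub ?_, ?_⟩
        · exact (((((hasDerivAt_id s).sub_const t₀).const_mul (-c)).exp).const_mul N).mul_const _
        · have hE : 0 ≤ N * Real.exp (-c * (s - t₀)) := by positivity
          have hyL : y / L ≤ 1 := (div_le_one hL).2 hy.2.le
          have e1 : K * (1 / L) = 2 * c := by rw [hcdef]; field_simp
          have : K * (vx y s - N * Real.exp (-c * (s - t₀)) * (1 / L)) =
            K * vx y s - N * Real.exp (-c * (s - t₀)) * (2 * c) := by rw [← e1]; ring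
          rw [this]
          have h3 : N * Real.exp (-c * (s - t₀)) * c * (y / L) ≤
            N * Real.exp (-c * (s - t₀)) * c * 1 := by gcongr
          nlinarith)
      (by
        intro s hs
        have : 0 ≤ N * Real.exp (-c * (s - t₀)) * (1 + 0 / L) := by positivity
        linarith [h0 s hs.2])
      (by
        intro s hs
        have : 0 ≤ N * Real.exp (-c * (s - t₀)) * (1 + L / L) := by positivity
        linarith [h1 s hs.2])
      (by
        intro y hy
        have h3 : 0 ≤ y / L := div_nonneg hy.1 hL.le
        have := hM y hy t₀
        have h4 : M ≤ N := le_max_left _ _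
        simp only [sub_self, mul_zero, Real.exp_zero]
        nlinarith)
      x hx t ⟨ht₀, ht⟩
    linarith
  have hlim : Tendsto (fun t₀ : ℝ => m + N * Real.exp (-c * (t - t₀)) * (1 + x / L)) atBot
      (𝓝 (m + N * 0 * (1 + x / L))) := by
    refine ((Tendsto.const_mul N (Real.tendsto_exp_atBot.comp ?_)).mul_const _).const_add m
    have : (fun t₀ : ℝ => -c * (t - t₀)) = fun t₀ => c * t₀ + (-c * t) := by ext; ring
    rw [this]
    exact tendsto_atBot_add_const_right _ _ (tendsto_id.const_mul_atBot hc0)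
  have := ge_of_tendsto hlim (by filter_upwards [eventually_le_atBot t] with t₀ h using key t₀ h)
  simpa using this
end

section
open MeasureTheory Set Filter Topology

lemma aux_norm_sin_le (z : ℂ) (hz : 0 ≤ z.im) : ‖Complex.sin z‖ ≤ Real.exp z.im := by
  rw [Complex.sin]
  have h1 : ‖Complex.exp (-z * Complex.I)‖ = Real.exp z.im := by rw [Complex.norm_exp]; simp
  have h2 : ‖Complex.exp (z * Complex.I)‖ = Real.exp (-z.im) := by rw [Complex.norm_exp]; simp
  have h3 : Real.exp (-z.im) ≤ Real.exp z.im := Real.exp_le_exp.2 (by linarith)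
  have := norm_sub_le (Complex.exp (-z * Complex.I)) (Complex.exp (z * Complex.I))
  rw [norm_div, norm_mul, Complex.norm_I, Complex.norm_two]
  linarith

lemma aux_norm_cos_le (z : ℂ) (hz : 0 ≤ z.im) : ‖Complex.cos z‖ ≤ Real.exp z.im := by
  rw [Complex.cos]
  have h1 : ‖Complex.exp (-z * Complex.I)‖ = Real.exp z.im := by rw [Complex.norm_exp]; simp
  have h2 : ‖Complex.exp (z * Complex.I)‖ = Real.exp (-z.im) := by rw [Complex.norm_exp]; simp
  have h3 : Real.exp (-z.im) ≤ Real.exp z.im := Real.exp_le_exp.2 (by linarith)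
  have := norm_add_le (Complex.exp (z * Complex.I)) (Complex.exp (-z * Complex.I))
  rw [norm_div, Complex.norm_two]
  linarith

lemma aux_norm_sin_ge (z : ℂ) : (Real.exp z.im - Real.exp (-z.im)) / 2 ≤ ‖Complex.sin z‖ := by
  rw [Complex.sin]
  have h1 : ‖Complex.exp (-z * Complex.I)‖ = Real.exp z.im := by rw [Complex.norm_exp]; simp
  have h2 : ‖Complex.exp (z * Complex.I)‖ = Real.exp (-z.im) := by rw [Complex.norm_exp]; simp
  have := norm_sub_norm_le (Complex.exp (-z * Complex.I)) (Complex.exp (z * Complex.I))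
  rw [norm_div, norm_mul, Complex.norm_I, Complex.norm_two]
  linarith

noncomputable def aR (D K a : ℝ) : ℝ := Real.sqrt (K ^ 2 + 4 * D ^ 2 * a ^ 2)
noncomputable def aMu (D K a : ℝ) : ℂ := (a : ℂ) + Complex.I * ((aR D K a / (2 * D) : ℝ) : ℂ)
noncomputable def aP (D K a : ℝ) : ℝ := a * aR D K a
noncomputable def aPd (D K a : ℝ) : ℝ := aR D K a + 4 * D ^ 2 * a ^ 2 / aR D K a
noncomputable def aS (D K L x a : ℝ) : ℂ :=
  Complex.exp ((K / (2 * D) : ℝ) * (x : ℂ)) * Complex.sin (aMu D K a * ((L : ℂ) - x)) /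
    Complex.sin (aMu D K a * L)
noncomputable def aC (D K L x a : ℝ) : ℂ :=
  Complex.exp ((K / (2 * D) : ℝ) * (x : ℂ)) * Complex.cos (aMu D K a * ((L : ℂ) - x)) /
    Complex.sin (aMu D K a * L)

section
variable {D K L : ℝ}

lemma aR_sq (D K a : ℝ) : aR D K a ^ 2 = K ^ 2 + 4 * D ^ 2 * a ^ 2 := by
  rw [aR, Real.sq_sqrt (by positivity)]

lemma aR_ge_K (_ : 0 < K) (a : ℝ) : K ≤ aR D K a := by
  apply Real.le_sqrt_of_sq_le; nlinarith [sq_nonneg (D * a)]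

lemma aR_pos (hK : 0 < K) (a : ℝ) : 0 < aR D K a := hK.trans_le (aR_ge_K hK a)

lemma aR_ge_a (_ : 0 < D) (a : ℝ) : 2 * D * |a| ≤ aR D K a := by
  apply Real.le_sqrt_of_sq_le; rw [mul_pow, sq_abs]; nlinarith [sq_nonneg K]

lemma aR_le (hD : 0 < D) (hK : 0 < K) (a : ℝ) : aR D K a ≤ K + 2 * D * |a| := by
  apply Real.sqrt_le_iff.2 ⟨by positivity, ?_⟩
  have : (2 * D * |a|) ^ 2 = 4 * D ^ 2 * a ^ 2 := by rw [mul_pow, sq_abs]; ring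
  have h2 : 0 ≤ K * (2 * D * |a|) := by positivity
  nlinarith

lemma aR_cont (D K : ℝ) : Continuous (aR D K) := by unfold aR; fun_prop
lemma aMu_cont (D K : ℝ) : Continuous (aMu D K) := by
  unfold aMu; have := aR_cont D K; fun_prop
lemma aP_cont (D K : ℝ) : Continuous (aP D K) := by
  unfold aP; have := aR_cont D K; fun_prop
lemma aPd_cont (hK : 0 < K) : Continuous (aPd D K) := by
  unfold aPd; have := aR_cont D K
  exact this.add ((by fun_prop : Continuous fun a : ℝ => 4 * D ^ 2 * a ^ 2).div this
    fun a => (aR_pos hK a).ne')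

lemma aPd_pos (hK : 0 < K) (a : ℝ) : 0 < aPd D K a := by
  have := aR_pos (D := D) hK a
  unfold aPd; positivity

lemma aPd_le (hD : 0 < D) (hK : 0 < K) (a : ℝ) : aPd D K a ≤ 2 * (K + 2 * D * |a|) := by
  have h0 := aR_pos (D := D) hK a
  have : 4 * D ^ 2 * a ^ 2 / aR D K a ≤ aR D K a := by
    rw [div_le_iff₀ h0, ← sq, aR_sq]; nlinarith
  unfold aPd
  linarith [aR_le hD hK a]

lemma aP_deriv (hK : 0 < K) (a : ℝ) : HasDerivAt (aP D K) (aPd D K a) a := by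
  have h0 : (K ^ 2 + 4 * D ^ 2 * a ^ 2) ≠ 0 := by positivity
  have h1 : HasDerivAt (fun a : ℝ => K ^ 2 + 4 * D ^ 2 * a ^ 2) (4 * D ^ 2 * (2 * a)) a := by
    simpa using (((hasDerivAt_pow 2 a).const_mul (4 * D ^ 2)).const_add (K ^ 2))
  have h2 := (hasDerivAt_id a).mul (h1.sqrt h0)
  have h3 := aR_pos (D := D) hK a
  refine (h2.congr_deriv ?_)
  simp only [id, aPd, aR] at *
  field_simp

lemma aMu_re (a : ℝ) : (aMu D K a).re = a := by
  rw [aMu, Complex.add_re, Complex.I_mul_re, Complex.ofReal_im, Complex.ofReal_re]; simp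
lemma aMu_im (a : ℝ) : (aMu D K a).im = aR D K a / (2 * D) := by
  rw [aMu, Complex.add_im, Complex.I_mul_im, Complex.ofReal_im, Complex.ofReal_re]; simp

lemma aMu_im_ge (hD : 0 < D) (a : ℝ) : |a| ≤ (aMu D K a).im := by
  rw [aMu_im, le_div_iff₀ (by positivity)]
  linarith [aR_ge_a (K := K) hD a]

lemma aMu_im_ge' (hD : 0 < D) (hK : 0 < K) (a : ℝ) : K / (2 * D) ≤ (aMu D K a).im := by
  rw [aMu_im]
  have := aR_ge_K (D := D) hK a
  gcongr

lemma aMu_normsq_le (hD : 0 < D) (hK : 0 < K) (a : ℝ) :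
    ‖aMu D K a‖ ^ 2 ≤ (1 + 1 / D + (K / (2 * D)) ^ 2) * (1 + |aP D K a|) := by
  have h1 : ‖aMu D K a‖ ^ 2 = 2 * a ^ 2 + (K / (2 * D)) ^ 2 := by
    rw [← Complex.normSq_eq_norm_sq, Complex.normSq_apply, aMu_re, aMu_im]
    have := aR_sq D K a
    field_simp
    rw [this]; ring
  have h2 : 2 * D * a ^ 2 ≤ |aP D K a| := by
    rw [aP, abs_mul, abs_of_pos (aR_pos hK a), ← sq_abs a]
    nlinarith [aR_ge_a (K := K) hD a, abs_nonneg a]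
  have h3 : 2 * a ^ 2 ≤ 1 / D * |aP D K a| := by
    rw [one_div, ← div_eq_inv_mul, le_div_iff₀ hD]; linarith
  rw [h1]
  have : 0 ≤ 1 / D := by positivity
  have : 0 ≤ (K / (2 * D)) ^ 2 * |aP D K a| := by positivity
  nlinarith [abs_nonneg (aP D K a)]

lemma aMu_norm_le (hD : 0 < D) (hK : 0 < K) (a : ℝ) :
    ‖aMu D K a‖ ≤ (2 + 1 / D + (K / (2 * D)) ^ 2) * (1 + |aP D K a|) := by
  have := aMu_normsq_le hD hK a
  nlinarith [sq_nonneg (‖aMu D K a‖ - 1), abs_nonneg (aP D K a)]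

lemma aSin_ne (hD : 0 < D) (hK : 0 < K) (hL : 0 < L) (a : ℝ) :
    Complex.sin (aMu D K a * L) ≠ 0 := by
  have h := aux_norm_sin_ge (aMu D K a * L)
  have h2 : 0 < (aMu D K a * L).im := by
    simp only [Complex.mul_im, Complex.ofReal_re, Complex.ofReal_im, mul_zero, zero_add]
    exact mul_pos (lt_of_lt_of_le (by positivity) (aMu_im_ge' hD hK a)) hL
  have h3 : Real.exp (-(aMu D K a * L).im) < Real.exp (aMu D K a * L).im :=
    Real.exp_lt_exp.2 (by linarith)
  intro h0
  rw [h0, norm_zero] at h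
  linarith

noncomputable def aB (D K L : ℝ) : ℝ :=
  Real.exp (K / (2 * D) * L) * (2 / (1 - Real.exp (-(2 * (K / (2 * D)) * L))))

lemma aB_pos (hD : 0 < D) (hK : 0 < K) (hL : 0 < L) : 0 < aB D K L := by
  unfold aB
  have : Real.exp (-(2 * (K / (2 * D)) * L)) < 1 := by
    rw [Real.exp_lt_one_iff]; have : 0 < 2 * (K / (2 * D)) * L := by positivity
    linarith
  have h2 : 0 < 1 - Real.exp (-(2 * (K / (2 * D)) * L)) := by linarith
  positivity

lemma aux_ratio (hD : 0 < D) (hK : 0 < K) (hL : 0 < L) (x : ℝ) (hx : x ∈ Icc 0 L) (a : ℝ)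
    (n : ℂ) (hn : ‖n‖ ≤ Real.exp (aMu D K a * ((L : ℂ) - x)).im) :
    ‖Complex.exp ((K / (2 * D) : ℝ) * (x : ℂ)) * n / Complex.sin (aMu D K a * L)‖
      ≤ aB D K L * Real.exp (-(|a| * x)) := by
  have hk : 0 < K / (2 * D) := by positivity
  set k := K / (2 * D) with hkd
  set y := (aMu D K a).im with hy
  have hyk : k ≤ y := aMu_im_ge' hD hK a
  have hya : |a| ≤ y := aMu_im_ge hD a
  have i1 : (aMu D K a * ((L : ℂ) - x)).im = y * (L - x) := by
    rw [← Complex.ofReal_sub, Complex.im_mul_ofReal]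
  have i2 : (aMu D K a * (L : ℂ)).im = y * L := by rw [Complex.im_mul_ofReal]
  have hs := aux_norm_sin_ge (aMu D K a * L)
  rw [i1] at hn
  rw [i2] at hs
  have hq : Real.exp (-(2 * k * L)) < 1 := by
    rw [Real.exp_lt_one_iff]; have : 0 < 2 * k * L := by positivity
    linarith
  have hs2 : Real.exp (y * L) * ((1 - Real.exp (-(2 * k * L))) / 2) ≤
      ‖Complex.sin (aMu D K a * L)‖ := by
    refine le_trans ?_ hs
    have : Real.exp (-(y * L)) ≤ Real.exp (y * L) * Real.exp (-(2 * k * L)) := by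
      rw [← Real.exp_add, Real.exp_le_exp]
      nlinarith
    linarith
  have hp : 0 < Real.exp (y * L) * ((1 - Real.exp (-(2 * k * L))) / 2) :=
    mul_pos (Real.exp_pos _) (by linarith)
  rw [norm_div, norm_mul, div_le_iff₀ (hp.trans_le hs2)]
  have e0 : ‖Complex.exp ((k : ℝ) * (x : ℂ))‖ = Real.exp (k * x) := by
    rw [Complex.norm_exp]; simp
  rw [e0]
  have hB := aB_pos hD hK hL
  calc Real.exp (k * x) * ‖n‖ ≤ Real.exp (k * L) * Real.exp (y * (L - x)) := by
        gcongr
        exact hx.2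
    _ ≤ Real.exp (k * L) * (Real.exp (-(|a| * x)) * Real.exp (y * L)) := by
        rw [← Real.exp_add (-(|a| * x))]
        gcongr
        nlinarith [hx.1]
    _ = aB D K L * Real.exp (-(|a| * x)) *
        (Real.exp (y * L) * ((1 - Real.exp (-(2 * k * L))) / 2)) := by
        rw [aB, ← hkd]
        generalize Real.exp (-(2 * k * L)) = q at hq
        have : 1 - q ≠ 0 := by linarith
        field_simp
    _ ≤ _ := by gcongr

lemma aux_im_nonneg (hD : 0 < D) (hK : 0 < K) (x : ℝ) (hx : x ∈ Icc 0 L) (a : ℝ) :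
    0 ≤ (aMu D K a * ((L : ℂ) - x)).im := by
  rw [← Complex.ofReal_sub, Complex.im_mul_ofReal]
  exact mul_nonneg (le_trans (by positivity) (aMu_im_ge' hD hK a)) (by linarith [hx.2])

lemma aS_le' (hD : 0 < D) (hK : 0 < K) (hL : 0 < L) (x : ℝ) (hx : x ∈ Icc 0 L) (a : ℝ) :
    ‖aS D K L x a‖ ≤ aB D K L * Real.exp (-(|a| * x)) :=
  aux_ratio hD hK hL x hx a _ (aux_norm_sin_le _ (aux_im_nonneg hD hK x hx a))

lemma aC_le' (hD : 0 < D) (hK : 0 < K) (hL : 0 < L) (x : ℝ) (hx : x ∈ Icc 0 L) (a : ℝ) :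
    ‖aC D K L x a‖ ≤ aB D K L * Real.exp (-(|a| * x)) :=
  aux_ratio hD hK hL x hx a _ (aux_norm_cos_le _ (aux_im_nonneg hD hK x hx a))

lemma aux_drop (hD : 0 < D) (hK : 0 < K) (hL : 0 < L) (x : ℝ) (hx : x ∈ Icc 0 L) (a : ℝ) :
    aB D K L * Real.exp (-(|a| * x)) ≤ aB D K L := by
  have := aB_pos hD hK hL
  have h2 : Real.exp (-(|a| * x)) ≤ 1 := by
    rw [Real.exp_le_one_iff]; have := mul_nonneg (abs_nonneg a) hx.1; linarith
  nlinarith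

lemma aS_le (hD : 0 < D) (hK : 0 < K) (hL : 0 < L) (x : ℝ) (hx : x ∈ Icc 0 L) (a : ℝ) :
    ‖aS D K L x a‖ ≤ aB D K L := (aS_le' hD hK hL x hx a).trans (aux_drop hD hK hL x hx a)

lemma aC_le (hD : 0 < D) (hK : 0 < K) (hL : 0 < L) (x : ℝ) (hx : x ∈ Icc 0 L) (a : ℝ) :
    ‖aC D K L x a‖ ≤ aB D K L := (aC_le' hD hK hL x hx a).trans (aux_drop hD hK hL x hx a)

lemma aS_cont_a (hD : 0 < D) (hK : 0 < K) (hL : 0 < L) (x : ℝ) : Continuous (aS D K L x) := by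
  unfold aS
  have := aMu_cont D K
  exact (by fun_prop : Continuous fun a : ℝ => Complex.exp ((K / (2 * D) : ℝ) * (x : ℂ)) *
    Complex.sin (aMu D K a * ((L : ℂ) - x))).div (by fun_prop) (aSin_ne hD hK hL)

lemma aC_cont_a (hD : 0 < D) (hK : 0 < K) (hL : 0 < L) (x : ℝ) : Continuous (aC D K L x) := by
  unfold aC
  have := aMu_cont D K
  exact (by fun_prop : Continuous fun a : ℝ => Complex.exp ((K / (2 * D) : ℝ) * (x : ℂ)) *
    Complex.cos (aMu D K a * ((L : ℂ) - x))).div (by fun_prop) (aSin_ne hD hK hL)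

lemma aS_cont_x (a : ℝ) : Continuous (fun x => aS D K L x a) := by
  unfold aS; fun_prop

lemma aux_exp_deriv (k x : ℝ) :
    HasDerivAt (fun x : ℝ => Complex.exp ((k : ℝ) * (x : ℂ))) (Complex.exp (k * x) * k) x := by
  have h := ((hasDerivAt_id x).ofReal_comp.const_mul (k : ℂ)).cexp
  simpa using h

lemma aux_arg_deriv (m : ℂ) (L x : ℝ) :
    HasDerivAt (fun x : ℝ => m * ((L : ℂ) - x)) (-m) x := by
  have h := ((hasDerivAt_id x).ofReal_comp.const_sub (L : ℂ)).const_mul m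
  simpa using h

lemma aS_deriv (x a : ℝ) : HasDerivAt (fun x => aS D K L x a)
    ((K / (2 * D) : ℝ) * aS D K L x a - aMu D K a * aC D K L x a) x := by
  have h := ((aux_exp_deriv (K / (2 * D)) x).mul ((Complex.hasDerivAt_sin _).comp x (aux_arg_deriv (aMu D K a) L x))).div_const
    (Complex.sin (aMu D K a * L))
  refine h.congr_deriv ?_
  simp only [aS, aC, Function.comp]
  ring

lemma aC_deriv (x a : ℝ) : HasDerivAt (fun x => aC D K L x a)
    ((K / (2 * D) : ℝ) * aC D K L x a + aMu D K a * aS D K L x a) x := by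
  have h := ((aux_exp_deriv (K / (2 * D)) x).mul ((Complex.hasDerivAt_cos _).comp x (aux_arg_deriv (aMu D K a) L x))).div_const
    (Complex.sin (aMu D K a * L))
  refine h.congr_deriv ?_
  simp only [aS, aC, Function.comp]
  ring

lemma aMu_sq (hD : 0 < D) (a : ℝ) :
    (D : ℂ) * (aMu D K a ^ 2 + ((K / (2 * D) : ℝ) : ℂ) ^ 2) = Complex.I * aP D K a := by
  have h := aR_sq D K a
  have hD' : (D : ℂ) ≠ 0 := by exact_mod_cast hD.ne'
  have h' : (aR D K a : ℂ) ^ 2 = K ^ 2 + 4 * D ^ 2 * a ^ 2 := by exact_mod_cast h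
  have hI : Complex.I ^ 2 = -1 := Complex.I_sq
  simp only [aMu, aP]
  push_cast
  field_simp
  ring_nf
  rw [hI, h']
  ring
end
end

section
open MeasureTheory Set Filter Topology

lemma aux_int (q : ℝ → ℝ) (F k : ℝ → ℂ) (C : ℝ) (hF : Continuous F)
    (hb : ∀ a, ‖F a‖ ≤ C * (1 + |q a|)) (hk : AEStronglyMeasurable k)
    (hi : Integrable (fun a => (1 + |q a|) * ‖k a‖)) : Integrable (fun a => F a * k a) := by
  refine (hi.const_mul C).mono' (hF.aestronglyMeasurable.mul hk) (Eventually.of_forall fun a => ?_)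
  rw [norm_mul]
  calc ‖F a‖ * ‖k a‖ ≤ C * (1 + |q a|) * ‖k a‖ := by gcongr; exact hb a
    _ = _ := by ring

lemma aux_diff (s : Set ℝ) (hs : IsOpen s) (q : ℝ → ℝ) (F F' : ℝ → ℝ → ℂ) (k : ℝ → ℂ) (C : ℝ)
    (hF : ∀ x, Continuous (F x)) (hF' : ∀ x, Continuous (F' x))
    (hb : ∀ x ∈ s, ∀ a, ‖F x a‖ ≤ C * (1 + |q a|))
    (hb' : ∀ x ∈ s, ∀ a, ‖F' x a‖ ≤ C * (1 + |q a|))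
    (hd : ∀ x a, HasDerivAt (fun x => F x a) (F' x a) x)
    (hk : AEStronglyMeasurable k)
    (hi : Integrable (fun a => (1 + |q a|) * ‖k a‖)) (x : ℝ) (hx : x ∈ s) :
    HasDerivAt (fun x => ∫ a, F x a * k a) (∫ a, F' x a * k a) x := by
  refine (hasDerivAt_integral_of_dominated_loc_of_deriv_le (hs.mem_nhds hx)
    (Eventually.of_forall fun y => ((hF y).aestronglyMeasurable.mul hk))
    (aux_int q (F x) k C (hF x) (hb x hx) hk hi)
    ((hF' x).aestronglyMeasurable.mul hk) (bound := fun a => C * ((1 + |q a|) * ‖k a‖))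
    (Eventually.of_forall fun a y hy => ?_) (hi.const_mul C)
    (Eventually.of_forall fun a y hy => (hd y a).mul_const (k a))).2
  rw [norm_mul]
  calc ‖F' y a‖ * ‖k a‖ ≤ C * (1 + |q a|) * ‖k a‖ := by gcongr; exact hb' y hy a
    _ = _ := by ring

noncomputable def aE (D K t a : ℝ) : ℂ := Complex.exp (-(Complex.I * aP D K a) * t)

noncomputable def aW (D K L : ℝ) (h : ℝ → ℂ) (x t : ℝ) : ℂ :=
  ∫ a, aS D K L x a * (aE D K t a * h a)

noncomputable def aS1 (D K L x a : ℝ) : ℂ :=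
  (K / (2 * D) : ℝ) * aS D K L x a - aMu D K a * aC D K L x a

noncomputable def aS2 (D K L x a : ℝ) : ℂ :=
  (K / (2 * D) : ℝ) * aS1 D K L x a -
    aMu D K a * ((K / (2 * D) : ℝ) * aC D K L x a + aMu D K a * aS D K L x a)

section
variable {D K L : ℝ}

lemma aE_norm (t a : ℝ) : ‖aE D K t a‖ = 1 := by
  rw [aE, Complex.norm_exp]; simp

lemma aE_cont (t : ℝ) : Continuous (aE D K t) := by
  unfold aE; have := aP_cont D K; fun_prop

lemma aE_cont_t (a : ℝ) : Continuous (fun t => aE D K t a) := by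
  unfold aE; fun_prop

lemma aE_deriv (t a : ℝ) : HasDerivAt (fun t => aE D K t a)
    (-(Complex.I * aP D K a) * aE D K t a) t := by
  have h := ((hasDerivAt_id t).ofReal_comp.const_mul (-(Complex.I * aP D K a))).cexp
  refine h.congr_deriv ?_
  simp only [aE, id]
  push_cast
  ring

lemma aS1_cont (hD : 0 < D) (hK : 0 < K) (hL : 0 < L) (x : ℝ) : Continuous (aS1 D K L x) := by
  unfold aS1
  have := aMu_cont D K
  have := aS_cont_a hD hK hL x
  have := aC_cont_a hD hK hL x
  fun_prop

lemma aS2_cont (hD : 0 < D) (hK : 0 < K) (hL : 0 < L) (x : ℝ) : Continuous (aS2 D K L x) := by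
  unfold aS2
  have := aMu_cont D K
  have := aS_cont_a hD hK hL x
  have := aC_cont_a hD hK hL x
  have := aS1_cont hD hK hL x
  fun_prop

lemma aux_bounds (hD : 0 < D) (hK : 0 < K) (hL : 0 < L) : ∃ C, 0 ≤ C ∧ ∀ x ∈ Icc 0 L, ∀ a,
    ‖aS D K L x a‖ ≤ C * (1 + |aP D K a|) ∧ ‖aS1 D K L x a‖ ≤ C * (1 + |aP D K a|) ∧
    ‖aS2 D K L x a‖ ≤ C * (1 + |aP D K a|) := by
  set k := K / (2 * D) with hk
  have hk0 : 0 < k := by positivity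
  set B := aB D K L
  have hB : 0 < B := aB_pos hD hK hL
  set c := 2 + 1 / D + k ^ 2 with hc
  have hc0 : 0 < c := by positivity
  refine ⟨B + (k * B + c * B) + (k * (k * B + c * B) + k * B * c + c * B), by positivity, ?_⟩
  intro x hx a
  have s := aS_le hD hK hL x hx a
  have s' := aC_le hD hK hL x hx a
  have m1 : ‖aMu D K a‖ ≤ c * (1 + |aP D K a|) := aMu_norm_le hD hK a
  have m2 : ‖aMu D K a‖ ^ 2 ≤ c * (1 + |aP D K a|) := (aMu_normsq_le hD hK a).trans (by
    gcongr; linarith)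
  set P := 1 + |aP D K a| with hP
  have hP1 : 1 ≤ P := by linarith [abs_nonneg (aP D K a)]
  have nk : ‖((k : ℝ) : ℂ)‖ = k := by simp [abs_of_pos hk0]
  have b0 : ‖aS D K L x a‖ ≤ B * P := s.trans (by nlinarith)
  have b1 : ‖aS1 D K L x a‖ ≤ (k * B + c * B) * P := by
    unfold aS1
    refine (norm_sub_le _ _).trans ?_
    rw [norm_mul, norm_mul, ← hk, nk]
    calc k * ‖aS D K L x a‖ + ‖aMu D K a‖ * ‖aC D K L x a‖ ≤ k * (B * P) + (c * P) * B := by gcongr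
      _ = _ := by ring
  have b2 : ‖aS2 D K L x a‖ ≤ (k * (k * B + c * B) + k * B * c + c * B) * P := by
    unfold aS2
    rw [mul_add, ← mul_assoc, ← mul_assoc, ← sq]
    refine (norm_sub_le _ _).trans ?_
    refine (add_le_add_right (norm_add_le _ _) _).trans ?_
    rw [norm_mul, norm_mul, norm_mul, norm_mul, norm_pow, ← hk, nk]
    calc k * ‖aS1 D K L x a‖ + (‖aMu D K a‖ * k * ‖aC D K L x a‖ + ‖aMu D K a‖ ^ 2 * ‖aS D K L x a‖)
        ≤ k * ((k * B + c * B) * P) + ((c * P) * k * B + (c * P) * B) := by gcongr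
      _ = _ := by ring
  have z0 : 0 ≤ B * P := by positivity
  have z1 : 0 ≤ (k * B + c * B) * P := by positivity
  have z2 : 0 ≤ (k * (k * B + c * B) + k * B * c + c * B) * P := by positivity
  refine ⟨?_, ?_, ?_⟩ <;> nlinarith

lemma aW_deriv (hD : 0 < D) (hK : 0 < K) (hL : 0 < L) (h : ℝ → ℂ) (hm : AEStronglyMeasurable h)
    (hi : Integrable (fun a => (1 + |aP D K a|) * ‖h a‖)) (x : ℝ) (hx : x ∈ Ioo 0 L) (t : ℝ) :
    HasDerivAt (fun x => aW D K L h x t) (∫ a, aS1 D K L x a * (aE D K t a * h a)) x ∧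
    HasDerivAt (fun x => ∫ a, aS1 D K L x a * (aE D K t a * h a))
      (∫ a, aS2 D K L x a * (aE D K t a * h a)) x ∧
    HasDerivAt (fun t => aW D K L h x t)
      (D * (∫ a, aS2 D K L x a * (aE D K t a * h a)) -
        K * ∫ a, aS1 D K L x a * (aE D K t a * h a)) t := by
  obtain ⟨C, hC0, hC⟩ := aux_bounds hD hK hL
  have hm' : AEStronglyMeasurable (fun a => aE D K t a * h a) :=
    (aE_cont t).aestronglyMeasurable.mul hm
  have hi' : Integrable (fun a => (1 + |aP D K a|) * ‖aE D K t a * h a‖) := by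
    simpa only [norm_mul, aE_norm, one_mul] using hi
  have hsub : ∀ y ∈ Ioo 0 L, y ∈ Icc 0 L := fun y hy => ⟨hy.1.le, hy.2.le⟩
  refine ⟨?_, ?_, ?_⟩
  · exact aux_diff (Ioo 0 L) isOpen_Ioo (aP D K) (aS D K L) (aS1 D K L) _ C
      (aS_cont_a hD hK hL) (aS1_cont hD hK hL) (fun y hy a => (hC y (hsub y hy) a).1)
      (fun y hy a => (hC y (hsub y hy) a).2.1) (fun y a => aS_deriv y a) hm' hi' x hx
  · refine aux_diff (Ioo 0 L) isOpen_Ioo (aP D K) (aS1 D K L) (aS2 D K L) _ C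
      (aS1_cont hD hK hL) (aS2_cont hD hK hL) (fun y hy a => (hC y (hsub y hy) a).2.1)
      (fun y hy a => (hC y (hsub y hy) a).2.2) (fun y a => ?_) hm' hi' x hx
    exact ((aS_deriv y a).const_mul _).sub ((aC_deriv y a).const_mul _)
  · have hm2 : AEStronglyMeasurable (fun a => aS D K L x a * h a) :=
      (aS_cont_a hD hK hL x).aestronglyMeasurable.mul hm
    have hi2 : Integrable (fun a => (1 + |aP D K a|) * ‖aS D K L x a * h a‖) := by
      refine (hi.const_mul (aB D K L)).mono' ?_ (Eventually.of_forall fun a => ?_)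
      · exact ((by have := aP_cont D K; fun_prop : Continuous fun a => 1 + |aP D K a|
          ).aestronglyMeasurable).mul hm2.norm
      · have h1 := aS_le hD hK hL x (hsub x hx) a
        have h2 : 0 ≤ 1 + |aP D K a| := by positivity
        rw [norm_mul, norm_norm, norm_mul, Real.norm_of_nonneg h2]
        calc (1 + |aP D K a|) * (‖aS D K L x a‖ * ‖h a‖)
            ≤ (1 + |aP D K a|) * (aB D K L * ‖h a‖) := by gcongr
          _ = _ := by ring
    have key := aux_diff univ isOpen_univ (aP D K) (aE D K)
      (fun t a => -(Complex.I * aP D K a) * aE D K t a) _ 1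
      (fun t => aE_cont t) (fun t => by have := aP_cont D K; have := aE_cont (D := D) (K := K) t; fun_prop)
      (fun y _ a => by rw [aE_norm]; linarith [abs_nonneg (aP D K a)])
      (fun y _ a => by rw [norm_mul, aE_norm]; simp)
      (fun y a => aE_deriv y a) hm2 hi2 t (mem_univ _)
    have e1 : (fun t => aW D K L h x t) = fun t => ∫ a, aE D K t a * (aS D K L x a * h a) := by
      ext t; unfold aW; congr 1; ext a; ring
    rw [e1]
    refine key.congr_deriv ?_
    have i1 := aux_int (aP D K) (aS1 D K L x) _ C (aS1_cont hD hK hL x)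
      (fun a => (hC x (hsub x hx) a).2.1) hm' hi'
    have i2 := aux_int (aP D K) (aS2 D K L x) _ C (aS2_cont hD hK hL x)
      (fun a => (hC x (hsub x hx) a).2.2) hm' hi'
    rw [← integral_const_mul, ← integral_const_mul, ← integral_sub (i2.const_mul _) (i1.const_mul _)]
    congr 1
    ext a
    rw [← aMu_sq hD a]
    have hK2 : (K : ℂ) = 2 * D * ((K / (2 * D) : ℝ) : ℂ) := by
      have : (D : ℂ) ≠ 0 := by exact_mod_cast hD.ne'
      push_cast; field_simp
    simp only [aS2, aS1]
    generalize ((K / (2 * D) : ℝ) : ℂ) = k at *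
    rw [hK2]
    ring

lemma aW_cont (hD : 0 < D) (hK : 0 < K) (hL : 0 < L) (h : ℝ → ℂ) (hi : Integrable h) :
    ContinuousOn (fun p : ℝ × ℝ => aW D K L h p.1 p.2) (Icc 0 L ×ˢ univ) := by
  unfold aW
  refine continuousOn_of_dominated (bound := fun a => aB D K L * ‖h a‖) ?_ ?_
    (hi.norm.const_mul _) ?_
  · intro p hp
    exact (aS_cont_a hD hK hL _).aestronglyMeasurable.mul
      ((aE_cont _).aestronglyMeasurable.mul hi.aestronglyMeasurable)
  · intro p hp
    refine Eventually.of_forall fun a => ?_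
    rw [norm_mul, norm_mul, aE_norm, one_mul]
    gcongr
    exact aS_le hD hK hL _ hp.1 a
  · refine Eventually.of_forall fun a => Continuous.continuousOn ?_
    exact ((aS_cont_x a).comp continuous_fst).mul (((aE_cont_t a).comp continuous_snd).mul
      continuous_const)

lemma aW_bdd (hD : 0 < D) (hK : 0 < K) (hL : 0 < L) (h : ℝ → ℂ) (hi : Integrable h)
    (x : ℝ) (hx : x ∈ Icc 0 L) (t : ℝ) : ‖aW D K L h x t‖ ≤ ∫ a, aB D K L * ‖h a‖ := by
  refine norm_integral_le_of_norm_le (hi.norm.const_mul _) (Eventually.of_forall fun a => ?_)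
  rw [norm_mul, norm_mul, aE_norm, one_mul]
  gcongr
  exact aS_le hD hK hL _ hx a

lemma aW_L (h : ℝ → ℂ) (t : ℝ) : aW D K L h L t = 0 := by
  simp [aW, aS]

lemma aW_zero (hD : 0 < D) (hK : 0 < K) (hL : 0 < L) (h : ℝ → ℂ) (t : ℝ) :
    aW D K L h 0 t = ∫ a, aE D K t a * h a := by
  simp only [aW, aS]
  congr 1; ext a
  have := aSin_ne hD hK hL a
  simp [this]

/-- comparison -/
lemma aux_compare (hD : 0 < D) (hK : 0 < K) (hL : 0 < L) (h : ℝ → ℂ)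
    (hi : Integrable h) (hip : Integrable (fun a => (1 + |aP D K a|) * ‖h a‖))
    (u ux : ℝ → ℝ → ℝ) (f : ℝ → ℝ)
    (hsol : IsClassicalSolution D K L u ux (fun _ => 0) f (fun _ => 0)) (T ε : ℝ) (hε : 0 ≤ ε)
    (h0 : ∀ t ≤ 0, ‖aW D K L h 0 t‖ ≤ ε)
    (h1 : ∀ t ∈ Ioc 0 T, ‖(f t : ℂ) - aW D K L h 0 t‖ ≤ ε)
    (x : ℝ) (hx : x ∈ Icc 0 L) (t : ℝ) (ht : t ∈ Icc 0 T) :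
    ‖(u x t : ℂ) - aW D K L h x t‖ ≤ ε := by
  obtain ⟨uc, -, -, ud, ui, ub0, ub1⟩ := hsol
  have hre : ∀ z w : ℂ, ‖z‖ ≤ 1 → (z * w).re ≤ ‖w‖ := fun z w hz =>
    (Complex.re_le_norm _).trans (by rw [norm_mul]; nlinarith [norm_nonneg w])
  have hnorm : ∀ w : ℂ, (∀ z : ℂ, ‖z‖ ≤ 1 → (z * w).re ≤ ε) → ‖w‖ ≤ ε := by
    intro w H
    rcases eq_or_ne w 0 with rfl | hw
    · simpa using hε
    have hn : (‖w‖ : ℂ) ≠ 0 := by simpa using hw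
    have := H ((starRingEnd ℂ) w / ‖w‖) (by simp [hw])
    have e : (starRingEnd ℂ) w / ‖w‖ * w = ((‖w‖ : ℝ) : ℂ) := by
      rw [div_mul_eq_mul_div, Complex.conj_mul']; field_simp
    rwa [e, Complex.ofReal_re] at this
  have dre : ∀ (z : ℂ) (F : ℝ → ℂ) (F' : ℂ) (y : ℝ), HasDerivAt F F' y →
      HasDerivAt (fun y => (z * F y).re) (z * F').re y := by
    intro z F F' y hF
    have := (Complex.reCLM.hasFDerivAt (x := z * F y)).comp_hasDerivAt y (hF.const_mul z)
    exact this
  have wd := aW_deriv hD hK hL h hi.aestronglyMeasurable hip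
  set W1 : ℝ → ℝ → ℂ := fun x t => ∫ a, aS1 D K L x a * (aE D K t a * h a) with hW1
  set W2 : ℝ → ℝ → ℂ := fun x t => ∫ a, aS2 D K L x a * (aE D K t a * h a) with hW2
  have wc := aW_cont hD hK hL h hi
  have wi : ∀ y ∈ Icc 0 L, ‖aW D K L h y 0‖ ≤ ε := by
    intro y hy
    apply hnorm
    intro z hz
    refine aux_ancient D K L 0 ε (∫ a, aB D K L * ‖h a‖) hD hK hL hε
      (fun x t => (z * aW D K L h x t).re)
      (fun x t => (z * W1 x t).re) (fun x t => (z * W2 x t).re)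
      (fun x t => (z * (D * W2 x t - K * W1 x t)).re) ?_ ?_ ?_ ?_ ?_ y hy 0 le_rfl
    · exact Complex.continuous_re.comp_continuousOn (continuousOn_const.mul wc)
    · intro x hx t
      obtain ⟨d1, d2, d3⟩ := wd x hx t
      refine ⟨dre _ _ _ _ d1, dre _ _ _ _ d2, dre _ _ _ _ d3, le_of_eq ?_⟩
      rw [mul_sub, Complex.sub_re, mul_left_comm, Complex.re_ofReal_mul, mul_left_comm,
        Complex.re_ofReal_mul]
    · intro t ht
      exact (hre _ _ hz).trans (h0 t ht)
    · intro t ht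
      simpa [aW_L] using hε
    · intro x hx t
      exact (hre _ _ hz).trans (aW_bdd hD hK hL h hi x hx t)
  apply hnorm
  intro z hz
  refine aux_maxp D K L 0 T ε hD
      (fun x t => (z * ((u x t : ℂ) - aW D K L h x t)).re)
      (fun x t => (z * ((ux x t : ℂ) - W1 x t)).re)
      (fun x t => (z * (((deriv (fun x' => ux x' t) x : ℝ) : ℂ) - W2 x t)).re)
      (fun x t => (z * (((D * deriv (fun x' => ux x' t) x - K * ux x t : ℝ) : ℂ)
        - (D * W2 x t - K * W1 x t))).re) ?_ ?_ ?_ ?_ ?_ x hx t ht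
  · refine Complex.continuous_re.comp_continuousOn (continuousOn_const.mul (ContinuousOn.sub ?_ ?_))
    · exact Complex.continuous_ofReal.comp_continuousOn
        (uc.mono (prod_mono_right Icc_subset_Ici_self))
    · exact wc.mono (prod_mono_right (subset_univ _))
  · intro x hx t ht
    obtain ⟨d1, d2, d3⟩ := wd x hx t
    obtain ⟨c1, c2, c3⟩ := ud x hx t ht.1
    refine ⟨dre _ _ _ _ (c1.ofReal_comp.sub d1), dre _ _ _ _ (c2.hasDerivAt.ofReal_comp.sub d2),
      dre _ _ _ _ (c3.ofReal_comp.sub d3), le_of_eq ?_⟩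
    rw [← Complex.re_ofReal_mul, ← Complex.re_ofReal_mul, ← Complex.sub_re]
    congr 1
    push_cast
    ring
  · intro t ht
    refine (hre _ _ hz).trans ?_
    rw [ub0 t ht.1]
    exact h1 t ht
  · intro t ht
    simpa [aW_L, ub1 t ht.1] using hε
  · intro x hx
    refine (hre _ _ hz).trans ?_
    rw [ui x hx]
    simpa using wi x hx
end
end

section
open MeasureTheory Set Filter Topology
open scoped FourierTransform SchwartzMap ContDiff

lemma aux_approx (f : ℝ → ℝ) (hf : ContinuousOn f (Ici 0)) (hf0 : f 0 = 0) (t : ℝ) (ht : 0 < t)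
    (ε : ℝ) (hε : 0 < ε) : ∃ g : 𝓢(ℝ, ℂ), (∀ s ≤ 0, ‖g s‖ ≤ ε) ∧
      (∀ s ∈ Ioc 0 t, ‖(f s : ℂ) - g s‖ ≤ ε) ∧
      ∀ s, ‖g s - (Ioc 0 t).indicator (fun s => (f s : ℂ)) s‖ ≤
        (Icc (-1) (t + 2)).indicator (fun _ => ε) s +
        (Ioc t (t + ε)).indicator (fun _ => |f t|) s := by
  set δ := min ε 1 with hδ
  have hδ0 : 0 < δ := lt_min hε one_pos
  have hδ1 : δ ≤ 1 := min_le_right _ _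
  have hδε : δ ≤ ε := min_le_left _ _
  set χ : ℝ → ℝ := fun s => max 0 (min 1 (1 - (s - t) / δ)) with hχ
  set F : ℝ → ℂ := fun s => ((f (max 0 (min s t)) * χ s : ℝ) : ℂ) with hF
  have χ1 : ∀ s ≤ t, χ s = 1 := by
    intro s hs
    have : (s - t) / δ ≤ 0 := div_nonpos_of_nonpos_of_nonneg (by linarith) hδ0.le
    simp only [hχ]
    rw [min_eq_left (by linarith)]; simp
  have χ0 : ∀ s, t + δ ≤ s → χ s = 0 := by
    intro s hs
    have : 1 ≤ (s - t) / δ := by rw [le_div_iff₀ hδ0]; linarith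
    simp only [hχ]
    rw [min_eq_right (by linarith), max_eq_left (by linarith)]
  have χb : ∀ s, 0 ≤ χ s ∧ χ s ≤ 1 := fun s =>
    ⟨le_max_left _ _, max_le zero_le_one (min_le_left _ _)⟩
  have Fc : Continuous F := by
    have h1 : Continuous fun s => f (max 0 (min s t)) :=
      hf.comp_continuous (by fun_prop) (fun s => mem_Ici.2 (le_max_left _ _))
    have h2 : Continuous χ := by simp only [hχ]; fun_prop
    exact Complex.continuous_ofReal.comp (h1.mul h2)
  have Fneg : ∀ s ≤ 0, F s = 0 := by
    intro s hs
    have : max 0 (min s t) = 0 := max_eq_left ((min_le_left _ _).trans hs)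
    simp [hF, this, hf0]
  have Fmid : ∀ s ∈ Ioc 0 t, F s = f s := by
    intro s hs
    simp only [hF]
    rw [min_eq_left hs.2, max_eq_right hs.1.le, χ1 s hs.2, mul_one]
  have Fbig : ∀ s, t + δ ≤ s → F s = 0 := by
    intro s hs
    simp [hF, χ0 s hs]
  have Flate : ∀ s, t ≤ s → ‖F s‖ ≤ |f t| := by
    intro s hs
    simp only [hF]
    rw [min_eq_right hs, max_eq_right ht.le, Complex.norm_real, Real.norm_eq_abs, abs_mul,
      abs_of_nonneg (χb s).1]
    nlinarith [abs_nonneg (f t), (χb s).2]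
  have Fsupp : HasCompactSupport F := by
    apply HasCompactSupport.intro (isCompact_Icc (a := (0:ℝ)) (b := t + δ))
    intro s hs
    rw [mem_Icc, not_and_or] at hs
    rcases hs with hs | hs
    · exact Fneg s (by linarith)
    · exact Fbig s (by linarith)
  have Fu : UniformContinuous F := Fsupp.uniformContinuous_of_continuous Fc
  obtain ⟨r, hr, hFr⟩ := Metric.uniformContinuous_iff.1 Fu ε hε
  obtain ⟨g, gc, hg⟩ := Fc.exists_contDiff_dist_le_of_forall_mem_ball_dist_le (lt_min hr one_pos)
  have hgF : ∀ s, ‖g s - F s‖ ≤ ε := by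
    intro s
    rw [← dist_eq_norm]
    exact hg s ε fun y hy => (hFr (lt_of_lt_of_le hy (min_le_left _ _))).le
  have hgout : ∀ s ∉ Icc (-1) (t + 2), g s = 0 ∧ F s = 0 := by
    intro s hs
    have hz : ∀ y ∈ Metric.ball s 1, F y = 0 := by
      intro y hy
      rw [Metric.mem_ball, Real.dist_eq, abs_lt] at hy
      rw [mem_Icc, not_and_or] at hs
      rcases hs with hs | hs
      · exact Fneg y (by linarith)
      · exact Fbig y (by linarith)
    have hs0 := hz s (Metric.mem_ball_self one_pos)
    refine ⟨?_, hs0⟩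
    have := hg s 0 fun y hy => by
      rw [hs0, hz y (Metric.ball_subset_ball (min_le_right _ _) hy)]; simp
    rw [hs0] at this
    simpa using this
  have gsupp : HasCompactSupport g :=
    HasCompactSupport.intro (isCompact_Icc (a := (-1:ℝ)) (b := t + 2)) fun s hs => (hgout s hs).1
  refine ⟨gsupp.toSchwartzMap gc, ?_, ?_, ?_⟩
  · intro s hs
    have := hgF s
    rw [Fneg s hs, sub_zero] at this
    exact this
  · intro s hs
    have := hgF s
    rw [Fmid s hs, norm_sub_rev] at this
    exact this
  · intro s
    change ‖g s - _‖ ≤ _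
    have e : g s - (Ioc 0 t).indicator (fun s => (f s : ℂ)) s =
      (g s - F s) + (F s - (Ioc 0 t).indicator (fun s => (f s : ℂ)) s) := by ring
    rw [e]
    refine (norm_add_le _ _).trans (add_le_add ?_ ?_)
    · by_cases hs : s ∈ Icc (-1) (t + 2)
      · rw [indicator_of_mem hs]; exact hgF s
      · rw [indicator_of_notMem hs, (hgout s hs).1, (hgout s hs).2]; simp
    · have hnn : 0 ≤ (Ioc t (t + ε)).indicator (fun _ => |f t|) s :=
        indicator_nonneg (fun _ _ => abs_nonneg _) _
      rcases le_or_gt s 0 with h0 | h0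
      · rw [Fneg s h0, indicator_of_notMem (fun h => absurd h.1 (by linarith))]
        simpa using hnn
      rcases le_or_gt s t with h1 | h1
      · rw [Fmid s ⟨h0, h1⟩, indicator_of_mem (show s ∈ Ioc 0 t from ⟨h0, h1⟩)]
        simpa using hnn
      rw [indicator_of_notMem (fun h => absurd h.2 (by linarith)), sub_zero]
      rcases le_or_gt s (t + ε) with h2 | h2
      · rw [indicator_of_mem (show s ∈ Ioc t (t + ε) from ⟨h1, h2⟩)]
        exact Flate s h1.le
      · rw [Fbig s (by linarith), norm_zero]; exact hnn

section
variable {D K L : ℝ}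

lemma aP_strictMono (hK : 0 < K) : StrictMono (aP D K) :=
  strictMono_of_deriv_pos fun a => by rw [(aP_deriv hK a).deriv]; exact aPd_pos hK a

lemma aP_surj (hK : 0 < K) : Function.Surjective (aP D K) := by
  apply (aP_cont D K).surjective
  · refine tendsto_atTop_mono' _ ?_ (tendsto_id.const_mul_atTop hK)
    filter_upwards [eventually_ge_atTop 0] with a ha
    have := aR_ge_K (D := D) hK a
    simp only [aP, id]; nlinarith
  · refine tendsto_atBot_mono' _ ?_ (tendsto_id.const_mul_atBot hK)
    filter_upwards [eventually_le_atBot 0] with a ha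
    have := aR_ge_K (D := D) hK a
    simp only [aP, id]; nlinarith

noncomputable def aH (D K : ℝ) (g : ℝ → ℂ) (a : ℝ) : ℂ :=
  g (aP D K a / (2 * Real.pi)) * ((aPd D K a / (2 * Real.pi) : ℝ) : ℂ)

lemma aux_cv (hK : 0 < K) (G : ℝ → ℂ) :
    (Integrable G ↔ Integrable fun a => ((aPd D K a / (2 * Real.pi) : ℝ) : ℂ) *
      G (aP D K a / (2 * Real.pi))) ∧
    ∫ y, G y = ∫ a, ((aPd D K a / (2 * Real.pi) : ℝ) : ℂ) * G (aP D K a / (2 * Real.pi)) := by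
  have hpi : 0 < 2 * Real.pi := by positivity
  have hd : ∀ a ∈ (univ : Set ℝ), HasDerivWithinAt (fun a => aP D K a / (2 * Real.pi))
    (aPd D K a / (2 * Real.pi)) univ a := fun a _ => ((aP_deriv hK a).div_const _).hasDerivWithinAt
  have hinj : InjOn (fun a => aP D K a / (2 * Real.pi)) univ := by
    intro a _ b _ h
    exact (aP_strictMono hK).injective (by simpa [div_left_inj' hpi.ne'] using h)
  have him : (fun a => aP D K a / (2 * Real.pi)) '' univ = univ := by
    rw [image_univ, Function.Surjective.range_eq]
    intro y
    obtain ⟨a, ha⟩ := aP_surj (D := D) hK (y * (2 * Real.pi))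
    exact ⟨a, by simp only [ha]; field_simp⟩
  have habs : ∀ a, |aPd D K a / (2 * Real.pi)| = aPd D K a / (2 * Real.pi) := fun a =>
    abs_of_pos (div_pos (aPd_pos hK a) hpi)
  constructor
  · have := integrableOn_image_iff_integrableOn_abs_deriv_smul MeasurableSet.univ hd hinj G
    rw [him, integrableOn_univ, integrableOn_univ] at this
    simpa only [habs, Complex.real_smul] using this
  · have := integral_image_eq_integral_abs_deriv_smul MeasurableSet.univ hd hinj G
    rw [him, Measure.restrict_univ] at this
    simpa only [habs, Complex.real_smul] using this

lemma aH_props (hK : 0 < K) (g : 𝓢(ℝ, ℂ)) :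
    Integrable (aH D K (𝓕⁻ g : 𝓢(ℝ, ℂ))) ∧
    Integrable (fun a => (1 + |aP D K a|) * ‖aH D K (𝓕⁻ g : 𝓢(ℝ, ℂ)) a‖) ∧
    ∀ t, ∫ a, aE D K t a * aH D K (𝓕⁻ g : 𝓢(ℝ, ℂ)) a = g t := by
  set G : 𝓢(ℝ, ℂ) := 𝓕⁻ g with hG
  have hpi : 0 < 2 * Real.pi := by positivity
  have i1 : Integrable (aH D K G) := by
    have := (aux_cv (D := D) hK G).1.1 G.integrable
    refine this.congr (Eventually.of_forall fun a => ?_)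
    simp only [aH]; ring
  refine ⟨i1, ?_, ?_⟩
  · have j : Integrable fun y : ℝ => (y : ℂ) * G y := by
      refine (G.integrable_pow_mul volume 1).mono' (by
        have := G.continuous; exact Continuous.aestronglyMeasurable (by fun_prop)) ?_
      exact Eventually.of_forall fun y => by simp
    have j2 := ((aux_cv (D := D) hK _).1.1 j).norm.const_mul (2 * Real.pi)
    refine (i1.norm.add j2).congr (Eventually.of_forall fun a => ?_)
    simp only [aH, Pi.add_apply, norm_mul, Complex.norm_real, Real.norm_eq_abs, abs_div,
      abs_of_pos hpi]
    field_simp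
  · intro t
    have h1 : (𝓕 G : 𝓢(ℝ, ℂ)) t = g t := by rw [hG, FourierTransform.fourier_fourierInv_eq]
    rw [← h1, SchwartzMap.fourier_coe, Real.fourier_real_eq_integral_exp_smul,
      (aux_cv (D := D) hK (fun v => Complex.exp (((-2 * Real.pi * v * t : ℝ) : ℂ) * Complex.I) • G v)).2]
    congr 1; ext a
    have : Complex.exp (((-2 * Real.pi * (aP D K a / (2 * Real.pi)) * t : ℝ) : ℂ) * Complex.I) =
        aE D K t a := by
      rw [aE]; congr 1
      have : -2 * Real.pi * (aP D K a / (2 * Real.pi)) * t = - (aP D K a * t) := by field_simp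
      rw [this]; push_cast; ring
    rw [this, smul_eq_mul, aH]; ring
end
end

section
open MeasureTheory Set Filter Topology
open scoped FourierTransform SchwartzMap ContDiff

section
variable {D K L : ℝ}

lemma aKer_int (hD : 0 < D) (hK : 0 < K) (hL : 0 < L) (x : ℝ) (hx : x ∈ Ioo 0 L) :
    Integrable (fun a => aS D K L x a * ((aPd D K a / (2 * Real.pi) : ℝ) : ℂ)) := by
  have hB := aB_pos hD hK hL
  have hx0 := hx.1
  set A := 2 * (K + 2 * D) / (2 * Real.pi) with hA
  have hA0 : 0 ≤ A := by positivity
  set Q := 1 + 1 / x + 2 / x ^ 2 + 6 / x ^ 3 with hQ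
  have hc : Continuous (fun a => aS D K L x a * ((aPd D K a / (2 * Real.pi) : ℝ) : ℂ)) := by
    have := aS_cont_a hD hK hL x
    have := aPd_cont (D := D) hK
    fun_prop
  refine ((integrable_inv_one_add_sq).const_mul (aB D K L * A * Q)).mono'
    hc.aestronglyMeasurable (Eventually.of_forall fun a => ?_)
  have h1 := aS_le' hD hK hL x ⟨hx.1.le, hx.2.le⟩ a
  have h2 : ‖((aPd D K a / (2 * Real.pi) : ℝ) : ℂ)‖ ≤ A * (1 + |a|) := by
    rw [Complex.norm_real, Real.norm_of_nonneg (div_nonneg (aPd_pos hK a).le (by positivity)), hA,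
      div_mul_eq_mul_div]
    gcongr
    refine (aPd_le hD hK a).trans ?_
    nlinarith [mul_nonneg hK.le (abs_nonneg a)]
  have h3 : Real.exp (-(|a| * x)) * (1 + |a|) ≤ Q * (1 + a ^ 2)⁻¹ := by
    rw [Real.exp_neg, ← div_eq_mul_inv, le_div_iff₀ (by positivity), mul_assoc,
      inv_mul_le_iff₀ (Real.exp_pos _)]
    have hy : 0 ≤ |a| * x := by positivity
    have p0 : 1 ≤ Real.exp (|a| * x) := Real.one_le_exp hy
    have p1 := Real.pow_div_factorial_le_exp _ hy 1
    have p2 := Real.pow_div_factorial_le_exp _ hy 2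
    have p3 := Real.pow_div_factorial_le_exp _ hy 3
    simp only [Nat.factorial, Nat.cast_one, pow_one, div_one, mul_one, Nat.succ_eq_add_one] at p1 p2 p3
    norm_num at p1 p2 p3
    set E := Real.exp (|a| * x)
    have q1 : |a| ≤ E * (1 / x) := by rw [mul_one_div, le_div_iff₀ hx0]; exact p1
    have q2 : |a| ^ 2 ≤ E * (2 / x ^ 2) := by
      rw [← mul_div_assoc, le_div_iff₀ (by positivity), ← mul_pow]; linarith
    have q3 : |a| ^ 3 ≤ E * (6 / x ^ 3) := by
      rw [← mul_div_assoc, le_div_iff₀ (by positivity), ← mul_pow]; linarith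
    rw [← sq_abs a, hQ]
    nlinarith
  rw [norm_mul]
  calc ‖aS D K L x a‖ * ‖((aPd D K a / (2 * Real.pi) : ℝ) : ℂ)‖
      ≤ (aB D K L * Real.exp (-(|a| * x))) * (A * (1 + |a|)) := by gcongr
    _ = aB D K L * A * (Real.exp (-(|a| * x)) * (1 + |a|)) := by ring
    _ ≤ aB D K L * A * (Q * (1 + a ^ 2)⁻¹) := by gcongr
    _ = _ := by ring

lemma aTil_cont (f : ℝ → ℝ) (hf : ContinuousOn f (Ici 0)) (t : ℝ) (ht : 0 < t) :
    Continuous (fun a => tildeF f (Complex.I * aP D K a) t) := by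
  have e : ∀ a, tildeF f (Complex.I * aP D K a) t = ∫ τ in (0:ℝ)..t,
      Complex.exp (Complex.I * aP D K a * (τ : ℂ)) * (f (max 0 τ) : ℂ) := by
    intro a
    apply intervalIntegral.integral_congr
    intro τ hτ
    rw [uIcc_of_le ht.le] at hτ
    simp only
    rw [max_eq_right hτ.1]
  simp_rw [e]
  apply intervalIntegral.continuous_parametric_intervalIntegral_of_continuous'
  have h1 : Continuous fun s => f (max 0 s) :=
    hf.comp_continuous (by fun_prop) (fun s => mem_Ici.2 (le_max_left _ _))
  have := aP_cont D K
  have h2 : Continuous fun p : ℝ × ℝ => f (max 0 p.2) := h1.comp continuous_snd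
  have hP1 : Continuous fun p : ℝ × ℝ => aP D K p.1 := this.comp continuous_fst
  simp only [Function.uncurry_def]
  have h3 : Continuous fun p : ℝ × ℝ => Complex.I * (aP D K p.1 : ℂ) * (p.2 : ℂ) :=
    (continuous_const.mul (Complex.continuous_ofReal.comp hP1)).mul
      (Complex.continuous_ofReal.comp continuous_snd)
  exact (Complex.continuous_exp.comp h3).mul (Complex.continuous_ofReal.comp h2)

lemma aTil_bdd (f : ℝ → ℝ) (hf : ContinuousOn f (Ici 0)) (t : ℝ) (ht : 0 < t) :
    ∃ M, ∀ a, ‖tildeF f (Complex.I * aP D K a) t‖ ≤ M := by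
  obtain ⟨M, hM⟩ := (isCompact_Icc (a := (0:ℝ)) (b := t)).exists_bound_of_continuousOn
    (hf.mono Icc_subset_Ici_self)
  refine ⟨M * |t - 0|, fun a => intervalIntegral.norm_integral_le_of_norm_le_const fun τ hτ => ?_⟩
  rw [uIoc_of_le ht.le] at hτ
  rw [norm_mul, Complex.norm_exp, Complex.norm_real]
  simpa using hM τ ⟨hτ.1.le, hτ.2⟩

noncomputable def aInt (D K L : ℝ) (f : ℝ → ℝ) (x t a : ℝ) : ℂ :=
  aS D K L x a * ((aPd D K a / (2 * Real.pi) : ℝ) : ℂ) *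
    (aE D K t a * tildeF f (Complex.I * aP D K a) t)

lemma aInt_int (hD : 0 < D) (hK : 0 < K) (hL : 0 < L) (x : ℝ) (hx : x ∈ Ioo 0 L)
    (f : ℝ → ℝ) (hf : ContinuousOn f (Ici 0)) (t : ℝ) (ht : 0 < t) :
    Integrable (aInt D K L f x t) := by
  obtain ⟨M, hM⟩ := aTil_bdd (D := D) (K := K) f hf t ht
  refine (aKer_int hD hK hL x hx).mul_bdd (c := M)
    ((aE_cont t).mul (aTil_cont f hf t ht)).aestronglyMeasurable (Eventually.of_forall fun a => ?_)
  rw [norm_mul, aE_norm, one_mul]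
  exact hM a

lemma aux_hat_close (f : ℝ → ℝ) (hf : ContinuousOn f (Ici 0)) (t : ℝ) (ht : 0 < t)
    (ε : ℝ) (hε : 0 < ε) (g : 𝓢(ℝ, ℂ))
    (hg : ∀ s, ‖g s - (Ioc 0 t).indicator (fun s => (f s : ℂ)) s‖ ≤
        (Icc (-1) (t + 2)).indicator (fun _ => ε) s +
        (Ioc t (t + ε)).indicator (fun _ => |f t|) s) (a : ℝ) :
    ‖(𝓕⁻ g : 𝓢(ℝ, ℂ)) (aP D K a / (2 * Real.pi)) - tildeF f (Complex.I * aP D K a) t‖ ≤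
      ε * (t + 3 + |f t|) := by
  have e1 : (𝓕⁻ g : 𝓢(ℝ, ℂ)) (aP D K a / (2 * Real.pi)) =
      ∫ s : ℝ, Complex.exp (Complex.I * aP D K a * (s : ℂ)) * g s := by
    rw [SchwartzMap.fourierInv_coe, Real.fourierInv_eq']
    congr 1; ext s
    rw [smul_eq_mul]
    congr 2
    simp only [RCLike.inner_apply, conj_trivial]
    have : 2 * Real.pi * (aP D K a / (2 * Real.pi) * s) = aP D K a * s := by field_simp
    rw [this]; push_cast; ring
  have e2 : tildeF f (Complex.I * aP D K a) t =
      ∫ s : ℝ, Complex.exp (Complex.I * aP D K a * (s : ℂ)) *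
        (Ioc 0 t).indicator (fun s => (f s : ℂ)) s := by
    rw [tildeF, intervalIntegral.integral_of_le ht.le, ← integral_indicator measurableSet_Ioc]
    congr 1; ext s
    by_cases hs : s ∈ Ioc 0 t <;> simp [hs]
  have nE : ∀ s : ℝ, ‖Complex.exp (Complex.I * aP D K a * (s : ℂ))‖ = 1 := by
    intro s; rw [Complex.norm_exp]; simp
  have cE : Continuous fun s : ℝ => Complex.exp (Complex.I * aP D K a * (s : ℂ)) := by fun_prop
  have ig : Integrable (fun s : ℝ => Complex.exp (Complex.I * aP D K a * (s : ℂ)) * g s) :=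
    g.integrable.bdd_mul (c := 1) cE.aestronglyMeasurable (Eventually.of_forall fun s => (nE s).le)
  have if0 : Integrable ((Ioc 0 t).indicator (fun s => (f s : ℂ))) := by
    rw [integrable_indicator_iff measurableSet_Ioc]
    have : ContinuousOn (fun s => (f s : ℂ)) (Icc 0 t) :=
      Complex.continuous_ofReal.comp_continuousOn (hf.mono Icc_subset_Ici_self)
    exact (this.integrableOn_Icc).mono_set Ioc_subset_Icc_self
  have if1 : Integrable (fun s : ℝ => Complex.exp (Complex.I * aP D K a * (s : ℂ)) *
        (Ioc 0 t).indicator (fun s => (f s : ℂ)) s) :=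
    if0.bdd_mul (c := 1) cE.aestronglyMeasurable (Eventually.of_forall fun s => (nE s).le)
  rw [e1, e2, ← integral_sub ig if1]
  have b1 : Integrable ((Icc (-1) (t + 2)).indicator (fun _ : ℝ => ε)) := by
    rw [integrable_indicator_iff measurableSet_Icc]
    exact continuousOn_const.integrableOn_Icc
  have b2 : Integrable ((Ioc t (t + ε)).indicator (fun _ : ℝ => |f t|)) := by
    rw [integrable_indicator_iff measurableSet_Ioc]
    exact (continuousOn_const.integrableOn_Icc).mono_set Ioc_subset_Icc_self
  refine (norm_integral_le_of_norm_le (b1.add b2) (Eventually.of_forall fun s => ?_)).trans ?_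
  · rw [← mul_sub, norm_mul, nE, one_mul]
    exact hg s
  · simp only [Pi.add_apply]
    rw [integral_add b1 b2, integral_indicator measurableSet_Icc, integral_indicator measurableSet_Ioc,
      setIntegral_const, setIntegral_const]
    simp only [Measure.real, Real.volume_Icc, Real.volume_Ioc, smul_eq_mul]
    rw [ENNReal.toReal_ofReal (by linarith), ENNReal.toReal_ofReal (by linarith)]
    apply le_of_eq; ring

lemma aux_main (hD : 0 < D) (hK : 0 < K) (hL : 0 < L)
    (f : ℝ → ℝ) (hf : ContinuousOn f (Ici 0)) (hf0 : f 0 = 0) (u ux : ℝ → ℝ → ℝ)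
    (hsol : IsClassicalSolution D K L u ux (fun _ => 0) f (fun _ => 0))
    (x : ℝ) (hx : x ∈ Ioo 0 L) (t : ℝ) (ht : 0 < t) :
    (u x t : ℂ) = ∫ a, aInt D K L f x t a := by
  set N := ∫ a, ‖aS D K L x a * ((aPd D K a / (2 * Real.pi) : ℝ) : ℂ)‖ with hN
  have hki := aKer_int hD hK hL x hx
  have key : ∀ ε > 0, ‖(u x t : ℂ) - ∫ a, aInt D K L f x t a‖ ≤
      ε * (1 + (t + 3 + |f t|) * N) := by
    intro ε hε
    obtain ⟨g, g1, g2, g3⟩ := aux_approx f hf hf0 t ht ε hε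
    obtain ⟨i1, i2, i3⟩ := aH_props (D := D) hK g
    set h := aH D K (𝓕⁻ g : 𝓢(ℝ, ℂ)) with hh
    have c1 := aux_compare hD hK hL h i1 i2 u ux f hsol t ε hε.le
      (fun s hs => by rw [aW_zero hD hK hL, i3]; exact g1 s hs)
      (fun s hs => by rw [aW_zero hD hK hL, i3]; exact g2 s hs)
      x ⟨hx.1.le, hx.2.le⟩ t ⟨ht.le, le_rfl⟩
    have wi : Integrable (fun a => aS D K L x a * (aE D K t a * h a)) := by
      refine Integrable.bdd_mul (c := aB D K L) ?_ (aS_cont_a hD hK hL x).aestronglyMeasurable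
        (Eventually.of_forall fun a => aS_le hD hK hL x ⟨hx.1.le, hx.2.le⟩ a)
      exact i1.bdd_mul (c := 1) (aE_cont t).aestronglyMeasurable
        (Eventually.of_forall fun a => (aE_norm t a).le)
    have c2 : ‖aW D K L h x t - ∫ a, aInt D K L f x t a‖ ≤ ε * (t + 3 + |f t|) * N := by
      rw [aW, ← integral_sub wi (aInt_int hD hK hL x hx f hf t ht), hN, ← integral_const_mul]
      refine norm_integral_le_of_norm_le (hki.norm.const_mul _) (Eventually.of_forall fun a => ?_)
      have e : aS D K L x a * (aE D K t a * h a) - aInt D K L f x t a =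
        aE D K t a * ((𝓕⁻ g : 𝓢(ℝ, ℂ)) (aP D K a / (2 * Real.pi)) -
          tildeF f (Complex.I * aP D K a) t) *
          (aS D K L x a * ((aPd D K a / (2 * Real.pi) : ℝ) : ℂ)) := by
        simp only [hh, aH, aInt]; ring
      rw [e, norm_mul, norm_mul, aE_norm, one_mul]
      gcongr
      exact aux_hat_close f hf t ht ε hε g g3 a
    calc _ = ‖((u x t : ℂ) - aW D K L h x t) + (aW D K L h x t - ∫ a, aInt D K L f x t a)‖ := by
            congr 1; ring
      _ ≤ ε + ε * (t + 3 + |f t|) * N := (norm_add_le _ _).trans (add_le_add c1 c2)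
      _ = _ := by ring
  have hlim : Tendsto (fun ε : ℝ => ε * (1 + (t + 3 + |f t|) * N)) (𝓝[>] 0)
      (𝓝 (0 * (1 + (t + 3 + |f t|) * N))) :=
    (Continuous.tendsto (by fun_prop) 0).mono_left nhdsWithin_le_nhds
  have := ge_of_tendsto hlim (by filter_upwards [self_mem_nhdsWithin] with ε hε using key ε hε)
  rw [zero_mul] at this
  exact sub_eq_zero.1 (norm_le_zero_iff.1 this)

lemma aG_mu (hD : 0 < D) (a : ℝ) :
    gammaPlus D K a + Complex.I * ((K : ℂ) / (2 * (D : ℂ))) = aMu D K a := by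
  have : (D : ℂ) ≠ 0 := by exact_mod_cast hD.ne'
  simp only [gammaPlus, bPlus, aMu, aR]
  push_cast
  field_simp
  ring

lemma aG_omega (hD : 0 < D) (a : ℝ) :
    omegaF D K (gammaPlus D K a) = Complex.I * aP D K a := by
  have h0 : (D : ℂ) ≠ 0 := by exact_mod_cast hD.ne'
  rw [← aMu_sq hD a, ← aG_mu hD a, omegaF]
  push_cast
  generalize gammaPlus D K a = l
  field_simp
  ring_nf
  rw [Complex.I_sq]
  ring

lemma aG_delta (hD : 0 < D) (a : ℝ) :
    deltaF D K L (gammaPlus D K a) =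
      -2 * Complex.I * (Real.exp (-(K / (2 * D) * L)) : ℂ) * Complex.sin (aMu D K a * L) := by
  have h0 : (D : ℂ) ≠ 0 := by exact_mod_cast hD.ne'
  rw [deltaF, nuF, ← aG_mu hD a]
  generalize gammaPlus D K a = l
  rw [Complex.sin]
  have e1 : Complex.exp (-Complex.I * l * L) = (Real.exp (-(K / (2 * D) * L)) : ℂ) *
      Complex.exp (-((l + Complex.I * ((K : ℂ) / (2 * (D : ℂ)))) * L) * Complex.I) := by
    push_cast
    rw [← Complex.exp_add]
    congr 1
    field_simp
    ring_nf
    rw [Complex.I_sq]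
    ring
  have e2 : Complex.exp (-Complex.I * (-l - Complex.I * ((K : ℂ) / (D : ℂ))) * L) =
      (Real.exp (-(K / (2 * D) * L)) : ℂ) *
      Complex.exp (((l + Complex.I * ((K : ℂ) / (2 * (D : ℂ)))) * L) * Complex.I) := by
    push_cast
    rw [← Complex.exp_add]
    congr 1
    field_simp
    ring_nf
    rw [Complex.I_sq]
    ring
  rw [e1, e2]
  ring_nf
  rw [Complex.I_sq]
  ring

lemma aG_d (hD : 0 < D) (hK : 0 < K) (a : ℝ) :
    2 * D * aMu D K a * gammaPlusD D K a = Complex.I * aPd D K a := by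
  have h0 : (D : ℂ) ≠ 0 := by exact_mod_cast hD.ne'
  have h1 : (aR D K a : ℂ) ≠ 0 := by exact_mod_cast (aR_pos hK a).ne'
  simp only [gammaPlusD, aPd, aMu]
  change 2 * D * _ * (1 + Complex.I * ((2 * D * a / aR D K a : ℝ) : ℂ)) = _
  push_cast
  field_simp
  ring_nf
  rw [Complex.I_sq]
  ring

lemma aG_ker (hD : 0 < D) (hK : 0 < K) (hL : 0 < L) (x a : ℝ) :
    (((2 * D : ℝ) / (Real.pi : ℝ) : ℝ) : ℂ) * (Real.exp (-(K * (L - x) / (2 * D))) : ℂ) *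
      ((deltaF D K L (gammaPlus D K a))⁻¹ *
      ((gammaPlus D K a + Complex.I * ((K : ℂ) / (2 * (D : ℂ)))) *
        Complex.sin (((L - x : ℝ) : ℂ) *
          (gammaPlus D K a + Complex.I * ((K : ℂ) / (2 * (D : ℂ))))))
        * gammaPlusD D K a) =
      -(aS D K L x a * ((aPd D K a / (2 * Real.pi) : ℝ) : ℂ)) := by
  have h0 : (D : ℂ) ≠ 0 := by exact_mod_cast hD.ne'
  have hp : (Real.pi : ℂ) ≠ 0 := by exact_mod_cast Real.pi_ne_zero
  have hs := aSin_ne hD hK hL a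
  have hd := aG_d hD hK a
  rw [aG_mu hD, aG_delta hD, aS]
  have e1 : (Real.exp (-(K * (L - x) / (2 * D))) : ℂ) =
      (Real.exp (-(K / (2 * D) * L)) : ℂ) * Complex.exp ((K / (2 * D) : ℝ) * (x : ℂ)) := by
    push_cast
    rw [← Complex.exp_add]; congr 1; field_simp; ring
  have e2 : ((L - x : ℝ) : ℂ) * aMu D K a = aMu D K a * ((L : ℂ) - x) := by push_cast; ring
  rw [e1, e2]
  have he : (Real.exp (-(K / (2 * D) * L)) : ℂ) ≠ 0 := by
    exact_mod_cast (Real.exp_pos _).ne'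
  generalize (Real.exp (-(K / (2 * D) * L)) : ℂ) = e at *
  generalize Complex.exp ((K / (2 * D) : ℝ) * (x : ℂ)) = e' at *
  generalize Complex.sin (aMu D K a * ((L : ℂ) - x)) = s at *
  generalize Complex.sin (aMu D K a * L) = s' at *
  have : (aPd D K a : ℂ) = -Complex.I * (2 * D * aMu D K a * gammaPlusD D K a) := by
    rw [hd, ← mul_assoc]; simp
  push_cast
  rw [this]
  field_simp
  ring_nf
  try rw [Complex.I_sq]
  try ring
end
end

section
open Set
lemma aux_til_sub (f : ℝ → ℝ) (hf : ContinuousOn f (Ici 0)) (c : ℝ) (w : ℂ) (t : ℝ) (ht : 0 < t) :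
    tildeF (fun s => f s - c) w t = tildeF f w t - tildeF (fun _ => c) w t := by
  have hf' : ContinuousOn (fun s => (f s : ℂ)) (uIcc 0 t) := by
    rw [uIcc_of_le ht.le]
    exact Complex.continuous_ofReal.comp_continuousOn (hf.mono Icc_subset_Ici_self)
  have cE : Continuous fun s : ℝ => Complex.exp (w * (s : ℂ)) := by fun_prop
  rw [tildeF, tildeF, tildeF, ← intervalIntegral.integral_sub]
  · congr 1; ext s; push_cast; ring
  · exact (cE.continuousOn.mul hf').intervalIntegrable
  · exact (cE.mul continuous_const).intervalIntegrable _ _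

lemma aux_til_const (c : ℝ) (w : ℂ) (hw : w ≠ 0) (t : ℝ) :
    Complex.exp (-w * (t : ℂ)) * tildeF (fun _ => c) w t =
      c * (1 - Complex.exp (-w * (t : ℂ))) * w⁻¹ := by
  have e : Complex.exp (-w * (t : ℂ)) * Complex.exp (w * (t : ℂ)) = 1 := by
    rw [← Complex.exp_add]; simp
  rw [tildeF, intervalIntegral.integral_mul_const, integral_exp_mul_complex hw]
  simp only [Complex.ofReal_zero, mul_zero, Complex.exp_zero]
  rw [div_eq_mul_inv]
  linear_combination (w⁻¹ * c) * e
end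

/-- Example 2 (rainfall with time-dependent surface value): the solution with zero initial data,
surface value f₂(t) − θ₀ and zero bottom value is the sum of the flooding-type integral (with the
integrand extended to λ = 0 by its limiting value) and a contour integral involving f̃₂. -/
theorem statement_15
    (D₀ K₀ L : ℝ) (hD : 0 < D₀) (hK : 0 < K₀) (hL : 0 < L)
    (θ₀ : ℝ) (hθ₀ : 0 < θ₀) (f₂ : ℝ → ℝ)
    (hf₂c : ContinuousOn f₂ (Set.Ici 0)) (hf₂0 : f₂ 0 = θ₀)
    (u ux : ℝ → ℝ → ℝ)
    (hsol : IsClassicalSolution D₀ K₀ L u ux (fun _ => 0) (fun t => f₂ t - θ₀) (fun _ => 0))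
    (x t : ℝ) (hx : x ∈ Set.Ioo 0 L) (ht : 0 < t) :
    (u x t : ℂ) =
      (θ₀ : ℂ) * ((2 * D₀ : ℝ) / (Real.pi : ℝ) : ℝ) *
        (Real.exp (-(K₀ * (L - x) / (2 * D₀))) : ℂ) *
        contourPlus D₀ K₀ (fun l =>
          if l = 0 then
            ((-(t * K₀) * Real.sinh (K₀ * (L - x) / (2 * D₀)) /
              (2 * D₀ * (1 - Real.exp (-(K₀ * L / D₀)))) : ℝ) : ℂ)
          else
            (1 - Complex.exp (-omegaF D₀ K₀ l * (t : ℂ))) /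
              (omegaF D₀ K₀ l * deltaF D₀ K₀ L l) *
              ((l + Complex.I * ((K₀ : ℂ) / (2 * (D₀ : ℂ)))) *
                Complex.sin (((L - x : ℝ) : ℂ) *
                  (l + Complex.I * ((K₀ : ℂ) / (2 * (D₀ : ℂ)))))))
      - ((2 * D₀ : ℝ) / (Real.pi : ℝ) : ℝ) *
        (Real.exp (-(K₀ * (L - x) / (2 * D₀))) : ℂ) *
        contourPlus D₀ K₀ (fun l =>
          Complex.exp (-omegaF D₀ K₀ l * (t : ℂ)) / deltaF D₀ K₀ L l *
            tildeF f₂ (omegaF D₀ K₀ l) t *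
            ((l + Complex.I * ((K₀ : ℂ) / (2 * (D₀ : ℂ)))) *
              Complex.sin (((L - x : ℝ) : ℂ) *
                (l + Complex.I * ((K₀ : ℂ) / (2 * (D₀ : ℂ))))))) := by
  have hfc : ContinuousOn (fun t => f₂ t - θ₀) (Set.Ici 0) := hf₂c.sub continuousOn_const
  have hm := aux_main hD hK hL (fun t => f₂ t - θ₀) hfc (by simp [hf₂0]) u ux hsol x hx t ht
  have i1 := aInt_int hD hK hL x hx f₂ hf₂c t ht
  have i2 := aInt_int hD hK hL x hx (fun _ => θ₀) continuousOn_const t ht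
  have e0 : ∀ a, aInt D₀ K₀ L (fun t => f₂ t - θ₀) x t a =
      aInt D₀ K₀ L f₂ x t a - aInt D₀ K₀ L (fun _ => θ₀) x t a := by
    intro a
    simp only [aInt]
    rw [aux_til_sub f₂ hf₂c θ₀ _ t ht]
    ring
  rw [hm]
  simp_rw [e0]
  rw [integral_sub i1 i2]
  have h2 : ∫ a, aInt D₀ K₀ L f₂ x t a = -(((2 * D₀ : ℝ) / (Real.pi : ℝ) : ℝ) *
        (Real.exp (-(K₀ * (L - x) / (2 * D₀))) : ℂ) *
        contourPlus D₀ K₀ (fun l =>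
          Complex.exp (-omegaF D₀ K₀ l * (t : ℂ)) / deltaF D₀ K₀ L l *
            tildeF f₂ (omegaF D₀ K₀ l) t *
            ((l + Complex.I * ((K₀ : ℂ) / (2 * (D₀ : ℂ)))) *
              Complex.sin (((L - x : ℝ) : ℂ) *
                (l + Complex.I * ((K₀ : ℂ) / (2 * (D₀ : ℂ)))))))) := by
    rw [contourPlus, ← integral_const_mul, ← integral_neg]
    congr 1
    ext a
    have hk := aG_ker hD hK hL x a
    have ho := aG_omega (K := K₀) hD a
    rw [aInt, aE, ← ho]
    linear_combination (-(Complex.exp (-omegaF D₀ K₀ (gammaPlus D₀ K₀ a) * (t : ℂ)) *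
      tildeF f₂ (omegaF D₀ K₀ (gammaPlus D₀ K₀ a)) t)) * -hk
  have h1 : ∫ a, aInt D₀ K₀ L (fun _ => θ₀) x t a =
      -((θ₀ : ℂ) * ((2 * D₀ : ℝ) / (Real.pi : ℝ) : ℝ) *
        (Real.exp (-(K₀ * (L - x) / (2 * D₀))) : ℂ) *
        contourPlus D₀ K₀ (fun l =>
          if l = 0 then
            ((-(t * K₀) * Real.sinh (K₀ * (L - x) / (2 * D₀)) /
              (2 * D₀ * (1 - Real.exp (-(K₀ * L / D₀)))) : ℝ) : ℂ)
          else
            (1 - Complex.exp (-omegaF D₀ K₀ l * (t : ℂ))) /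
              (omegaF D₀ K₀ l * deltaF D₀ K₀ L l) *
              ((l + Complex.I * ((K₀ : ℂ) / (2 * (D₀ : ℂ)))) *
                Complex.sin (((L - x : ℝ) : ℂ) *
                  (l + Complex.I * ((K₀ : ℂ) / (2 * (D₀ : ℂ)))))))) := by
    rw [contourPlus, ← integral_const_mul, ← integral_neg]
    apply integral_congr_ae
    filter_upwards [Measure.ae_ne volume (0:ℝ)] with a ha
    have hk := aG_ker hD hK hL x a
    have ho := aG_omega (K := K₀) hD a
    have hg : gammaPlus D₀ K₀ a ≠ 0 := by
      intro h
      have := congrArg Complex.re h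
      simp [gammaPlus] at this
      exact ha this
    have hp : omegaF D₀ K₀ (gammaPlus D₀ K₀ a) ≠ 0 := by
      rw [ho]
      refine mul_ne_zero Complex.I_ne_zero ?_
      rw [aP]
      exact_mod_cast mul_ne_zero ha (aR_pos hK a).ne'
    have ht' := aux_til_const θ₀ _ hp t
    rw [if_neg hg, aInt, aE, ← ho]
    rw [ht', div_eq_mul_inv _ (_ * deltaF _ _ _ _), mul_inv]
    linear_combination (θ₀ * (1 - Complex.exp (-omegaF D₀ K₀ (gammaPlus D₀ K₀ a) * (t : ℂ))) *
      (omegaF D₀ K₀ (gammaPlus D₀ K₀ a))⁻¹) * hk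
  rw [h1, h2]
  ring
end
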